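/- arXiv:0705.2492 — 3 statements merged into one kernel-verified Lean document; each statement's English description precedes it below -/
import Mathlib

section
/- Let K be a field of characteristic zero and X a rank-two irreducible triangulable locally nilpotent K-derivation of K[x,y,z]. Let u,v,w be a coordinate system of K[x,y,z] such that X(u) = 0, X(v) = d(u) for some univariate polynomial d, and X(w) = q(u,v) for some q ∈ K[u,v]. Let c(u) be a generator of the plinth ideal S^X. Then d(u) = c(u)·e(u) with gcd(c(u), e(u)) = 1, and the ideal generated by e(u) and q(u,v) in K[u,v] is the unit ideal. -/
noncomputable section

variable (K : Type) [Field K] [CharZero K]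

abbrev PolyR (K : Type) [Field K] : Type := MvPolynomial (Fin 3) K

/-- A derivation is locally nilpotent if every element is killed by some iterate. -/
def LND (X : Derivation K (PolyR K) (PolyR K)) : Prop :=
  ∀ a : PolyR K, ∃ n : ℕ, 0 < n ∧ (⇑X)^[n] a = 0

/-- `X` is irreducible: every common divisor of `X x, X y, X z` is a unit. -/
def IrredDer (X : Derivation K (PolyR K) (PolyR K)) : Prop :=
  ∀ d : PolyR K, (∀ i : Fin 3, d ∣ X (MvPolynomial.X i)) → IsUnit d

def IsCoord (f : PolyR K) : Prop :=
  ∃ g h : PolyR K, Algebra.adjoin K {f, g, h} = ⊤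

def IsCoordSys (u v w : PolyR K) : Prop := Algebra.adjoin K {u, v, w} = ⊤

def IsSysOfCoords2 (u v : PolyR K) : Prop :=
  ∃ w : PolyR K, Algebra.adjoin K {u, v, w} = ⊤

/-- The corank of a derivation: the largest length of a system of coordinates in the kernel. -/
def corank (X : Derivation K (PolyR K) (PolyR K)) : ℕ :=
  sSup {r : ℕ | ∃ l : List (PolyR K), l.length = r ∧ (∀ f ∈ l, X f = 0) ∧
    ∃ m : List (PolyR K), (l ++ m).length = 3 ∧
      Algebra.adjoin K {a : PolyR K | a ∈ l ++ m} = ⊤}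

def rankD (X : Derivation K (PolyR K) (PolyR K)) : ℕ := 3 - corank K X

def IsLocalSlice (X : Derivation K (PolyR K) (PolyR K)) (s : PolyR K) : Prop :=
  X s ≠ 0 ∧ X (X s) = 0

def IsMinLocalSlice (X : Derivation K (PolyR K) (PolyR K)) (s : PolyR K) : Prop :=
  IsLocalSlice K X s ∧ ∀ v : PolyR K, IsLocalSlice K X v → X v ∣ X s →
    ∃ μ : (PolyR K)ˣ, X v = (μ : PolyR K) * X s

/-- `c` generates the plinth ideal `S^X = {X a : X² a = 0}` as an ideal of the constants. -/
def IsPlinthGen (X : Derivation K (PolyR K) (PolyR K)) (c : PolyR K) : Prop :=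
  {d : PolyR K | ∃ a : PolyR K, X a = d ∧ X (X a) = 0} =
    {d : PolyR K | ∃ r : PolyR K, X r = 0 ∧ d = r * c}

/-- `X` is triangulable: triangular in some coordinate system. -/
def Triangulable (X : Derivation K (PolyR K) (PolyR K)) : Prop :=
  ∃ u v w : PolyR K, IsCoordSys K u v w ∧
    X u ∈ (⊥ : Subalgebra K (PolyR K)) ∧
    X v ∈ Algebra.adjoin K {u} ∧
    X w ∈ Algebra.adjoin K {u, v}

/-- Evaluation of `Q ∈ K[u][T]` at `T = t`, with coefficients evaluated at `u`. -/
def ev2 (u t : PolyR K) (Q : Polynomial (Polynomial K)) : PolyR K :=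
  Polynomial.eval₂ (Polynomial.aeval u).toRingHom t Q

/-- The Jacobian derivation `Jac(f,g,·)` applied to `h`. -/
def jacDet (f g h : PolyR K) : PolyR K :=
  Matrix.det !![MvPolynomial.pderiv 0 f, MvPolynomial.pderiv 1 f, MvPolynomial.pderiv 2 f;
    MvPolynomial.pderiv 0 g, MvPolynomial.pderiv 1 g, MvPolynomial.pderiv 2 g;
    MvPolynomial.pderiv 0 h, MvPolynomial.pderiv 1 h, MvPolynomial.pderiv 2 h]


open Polynomial in
theorem tf_exists_antideriv {R : Type} [CommRing R] [Algebra ℚ R] (q : R[X]) :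
    ∃ Q : R[X], derivative Q = q := by
  induction q using Polynomial.induction_on' with
  | add p q hp hq =>
    obtain ⟨P, rfl⟩ := hp
    obtain ⟨Q, rfl⟩ := hq
    exact ⟨P + Q, by simp⟩
  | monomial n r =>
    refine ⟨monomial (n+1) (algebraMap ℚ R ((n+1 : ℚ)⁻¹) * r), ?_⟩
    rw [derivative_monomial]
    have h : (n + 1 : ℚ) ≠ 0 := by exact_mod_cast Nat.succ_ne_zero n
    congr 1
    have h2 : ((n + 1 : ℕ) : R) = algebraMap ℚ R (n + 1 : ℚ) := by simp
    rw [h2, mul_right_comm, ← map_mul, inv_mul_cancel₀ h]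
    simp

section core
open Polynomial
variable {R : Type} [CommRing R] [IsDomain R] [IsPrincipalIdealRing R] [Algebra ℚ R]
  [IsAddTorsionFree R]

theorem tf_D_C (D : Derivation ℤ R[X][X] R[X][X]) (hu : ∀ r : R, D (C (C r)) = 0) {d : R}
    (hv : D (C X) = C (C d)) (a : R[X]) :
    D (C a) = C (derivative a * C d) := by
  induction a using Polynomial.induction_on' with
  | add p q hp hq => simp [hp, hq, add_mul]
  | monomial n a =>
    rw [← C_mul_X_pow_eq_monomial]
    simp only [C_mul, C_pow, Derivation.leibniz, Derivation.leibniz_pow, hv, hu,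
      derivative_C_mul, derivative_X_pow, smul_eq_mul, nsmul_eq_mul]
    simp
    ring

theorem tf_D_coeff (D : Derivation ℤ R[X][X] R[X][X]) (hu : ∀ r : R, D (C (C r)) = 0) {d : R}
    (hv : D (C X) = C (C d)) {q : R[X]} (hw : D X = C q) (F : R[X][X]) (n : ℕ) :
    (D F).coeff n = derivative (F.coeff n) * C d + (n + 1) * F.coeff (n + 1) * q := by
  induction F using Polynomial.induction_on' with
  | add p q hp hq => simp [hp, hq]; ring
  | monomial m a =>
    rw [← C_mul_X_pow_eq_monomial]
    simp only [Derivation.leibniz, Derivation.leibniz_pow, hw, tf_D_C D hu hv,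
      smul_eq_mul, nsmul_eq_mul]
    rw [coeff_add, coeff_C_mul_X_pow, coeff_C_mul_X_pow, coeff_C_mul]
    have : (m : R[X][X]) * (X ^ (m-1) * C q) = C (m * q) * X ^ (m-1) := by
      simp; ring
    rw [this, mul_comm (X ^ m) (C _), coeff_C_mul_X_pow, coeff_C_mul_X_pow]
    rcases m with _ | m
    · by_cases h : n = 0 <;> simp [h]
    · simp only [Nat.add_sub_cancel, Nat.add_right_cancel_iff]
      by_cases h : n = m
      · subst h; simp; ring
      · by_cases h' : n = m + 1 <;> simp [h, h']

theorem tf_ker_aux (D : Derivation ℤ R[X][X] R[X][X]) (hu : ∀ r : R, D (C (C r)) = 0) {d : R}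
    (hd : d ≠ 0) (hv : D (C X) = C (C d)) {q Q : R[X]} (hw : D X = C q)
    (hQ : derivative Q = q) (n : ℕ) :
    ∀ t : R[X][X], degree t < n → D t = 0 →
      ∃ (N : ℕ) (g : R[X]), C (C (d ^ N)) * t =
        eval₂ (C.comp C) (C (C d) * X - C Q) g := by
  induction n with
  | zero =>
    intro t ht _
    refine ⟨0, 0, ?_⟩
    have : t = 0 := by simpa using ht
    simp [this]
  | succ n ih =>
    intro t ht hD
    have hp : D (C (C d) * X - C Q) = 0 := by
      simp only [_root_.map_sub, Derivation.leibniz, hw, hu, tf_D_C D hu hv, hQ, smul_eq_mul, C_mul]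
      ring
    have hc : t.coeff (n+1) = 0 := coeff_eq_zero_of_degree_lt ht
    have h1 := tf_D_coeff D hu hv hw t n
    rw [hD, hc] at h1
    simp only [coeff_zero, mul_zero, zero_mul, add_zero] at h1
    have h2 : derivative (t.coeff n) = 0 := by
      rcases mul_eq_zero.1 h1.symm with h | h
      · exact h
      · exact absurd (C_eq_zero.1 h) hd
    obtain ⟨a, ha⟩ : ∃ a, t.coeff n = C a := ⟨_, eq_C_of_derivative_eq_zero h2⟩
    have hdegp : degree (C (C d) * X - C Q) ≤ 1 := by
      rw [sub_eq_add_neg, ← C_neg]; exact degree_linear_le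
    have hdegpn : degree ((C (C d) * X - C Q) ^ n) ≤ (n : WithBot ℕ) := by
      simpa using degree_pow_le_of_le n hdegp
    have hcp : ((C (C d) * X - C Q) ^ n).coeff n = C (d ^ n) := by
      have := coeff_pow_of_natDegree_le (p := C (C d) * X - C Q) (m := n) (n := 1)
        (natDegree_le_of_degree_le hdegp)
      rw [mul_one] at this
      rw [this]; simp
    obtain ⟨N, g, hg⟩ := ih (C (C (d ^ n)) * t - C (C a) * (C (C d) * X - C Q) ^ n) (by
      rw [degree_lt_iff_coeff_zero]
      intro m hm
      rcases Nat.eq_or_lt_of_le hm with h | h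
      · subst h
        rw [coeff_sub, coeff_C_mul, coeff_C_mul, hcp, ha]; ring
      · rw [coeff_sub, coeff_C_mul, coeff_C_mul,
          coeff_eq_zero_of_degree_lt (lt_of_le_of_lt hdegpn (by exact_mod_cast h)),
          coeff_eq_zero_of_degree_lt (lt_of_lt_of_le ht (by exact_mod_cast h))]
        simp) (by
      simp only [_root_.map_sub, Derivation.leibniz, Derivation.leibniz_pow, hp, hD, hu]
      simp)
    refine ⟨N + n, g + C (d ^ N * a) * X ^ n, ?_⟩
    rw [eval₂_add, ← hg, eval₂_mul, eval₂_C, eval₂_pow, eval₂_X]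
    simp only [pow_add, C_mul, RingHom.comp_apply]
    ring

/-- setting `w = 0` -/
theorem tf_eval_zero (d : R) (Q g : R[X]) :
    eval 0 (eval₂ ((C : R[X] →+* R[X][X]).comp C) (C (C d) * X - C Q) g) = g.comp (-Q) := by
  rw [← coe_evalRingHom, hom_eval₂]
  have : (evalRingHom (0 : R[X])).comp ((C : R[X] →+* R[X][X]).comp C) = C := by
    ext <;> simp
  rw [this]
  simp [comp]

theorem tf_prime_dvd {d : R} {q Q : R[X]} (hQ : derivative Q = q)
    (hirr : ∀ π : R, π ∣ d → C π ∣ q → IsUnit π) (π : R) (hπ : Prime π) (hπd : π ∣ d)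
    (g : R[X])
    (hg : C (C π) ∣ eval₂ ((C : R[X] →+* R[X][X]).comp C) (C (C d) * X - C Q) g) :
    C π ∣ g := by
  have h0 : C π ∣ g.comp (-Q) := by
    rw [← tf_eval_zero d]
    obtain ⟨y, hy⟩ := hg
    rw [hy]
    exact ⟨eval 0 y, by simp⟩
  have key : ∀ f : R[X], C π ∣ f ↔ f.map (Ideal.Quotient.mk (Ideal.span {π})) = 0 := by
    intro f
    rw [C_dvd_iff_dvd_coeff, Polynomial.ext_iff]
    simp [Ideal.Quotient.eq_zero_iff_mem, Ideal.mem_span_singleton]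
  have : (Ideal.span {π}).IsPrime := (Ideal.span_singleton_prime hπ.ne_zero).2 hπ
  rw [key, map_comp, comp_eq_zero_iff] at h0
  rw [key]
  rcases h0 with h | ⟨-, h⟩
  · exact h
  · exfalso
    have h2 := congrArg derivative h
    rw [derivative_map, derivative_C, derivative_neg, hQ, ← key, dvd_neg] at h2
    exact hπ.not_isUnit (hirr π hπd h2)

theorem tf_dvd {d : R} (hd : d ≠ 0) {q Q : R[X]} (hQ : derivative Q = q)
    (hirr : ∀ π : R, π ∣ d → C π ∣ q → IsUnit π) (b : R) : b ∣ d → ∀ (g : R[X]),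
    C (C b) ∣ eval₂ ((C : R[X] →+* R[X][X]).comp C) (C (C d) * X - C Q) g →
    C b ∣ g := by
  induction b using UniqueFactorizationMonoid.induction_on_prime with
  | h₁ => intro h; exact absurd (zero_dvd_iff.1 h) hd
  | h₂ x hx => intro _ g _; exact (hx.map C).dvd
  | h₃ a p ha hp ih =>
    intro hb g hg
    have h1 : C (C p) ∣ C (C (p * a)) := by simp
    obtain ⟨g', rfl⟩ := tf_prime_dvd hQ hirr p hp (dvd_of_mul_right_dvd hb) g (h1.trans hg)
    rw [eval₂_mul, eval₂_C, RingHom.comp_apply, C_mul, C_mul] at hg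
    have := ih (dvd_of_mul_left_dvd hb) g' ((mul_dvd_mul_iff_left (by simpa using hp.ne_zero)).1 hg)
    rw [C_mul]
    exact mul_dvd_mul_left _ this

theorem tf_ker (D : Derivation ℤ R[X][X] R[X][X]) (hu : ∀ r : R, D (C (C r)) = 0) {d : R}
    (hd : d ≠ 0) (hv : D (C X) = C (C d)) {q Q : R[X]} (hw : D X = C q)
    (hQ : derivative Q = q) (hirr : ∀ π : R, π ∣ d → C π ∣ q → IsUnit π)
    (t : R[X][X]) (ht : D t = 0) :
    ∃ g : R[X], t = eval₂ (C.comp C) (C (C d) * X - C Q) g := by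
  obtain ⟨N, g, hg⟩ := tf_ker_aux D hu hd hv hw hQ (t.natDegree + 1) t
    (lt_of_le_of_lt degree_le_natDegree (by exact_mod_cast Nat.lt_succ_self _)) ht
  induction N generalizing g with
  | zero => exact ⟨g, by simpa using hg⟩
  | succ N ih =>
    have hdd : C (C d) * (C (C (d ^ N)) * t) = C (C (d ^ (N+1))) * t := by
      simp only [pow_succ, C_mul]; ring
    obtain ⟨g', rfl⟩ := tf_dvd hd hQ hirr d dvd_rfl g ⟨_, (hdd.trans hg).symm⟩
    apply ih g'
    rw [← hdd, eval₂_mul, eval₂_C, RingHom.comp_apply] at hg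
    exact mul_left_cancel₀ (by simpa using hd) hg

theorem tf_core (D : Derivation ℤ R[X][X] R[X][X]) (hu : ∀ r : R, D (C (C r)) = 0) {d : R}
    (hd : d ≠ 0) (hv : D (C X) = C (C d)) {q : R[X]} (hw : D X = C q)
    (hirr : ∀ π : R, π ∣ d → C π ∣ q → IsUnit π) (c : R)
    (hc1 : ∃ s, D s = C (C c)) (hc2 : ∀ s, D (D s) = 0 → C (C c) ∣ D s) :
    ∃ e : R, d = c * e ∧ IsCoprime c e ∧ IsCoprime (C e) q := by
  obtain ⟨Q, hQ⟩ := tf_exists_antideriv q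
  have hCC : ∀ a b : R, (C (C a) : R[X][X]) ∣ C (C b) → a ∣ b := by
    intro a b h
    rw [C_dvd_iff_dvd_coeff] at h
    have h := h 0
    rw [coeff_C_zero, C_dvd_iff_dvd_coeff] at h
    simpa using h 0
  have hD0 := hu
  obtain ⟨e, he⟩ : c ∣ d := by
    apply hCC
    rw [← hv]
    apply hc2
    rw [hv, hD0]
  have hc0 : c ≠ 0 := by rintro rfl; simp at he; exact hd he
  have he0 : e ≠ 0 := by rintro rfl; simp at he; exact hd he
  obtain ⟨s, hs⟩ := hc1
  obtain ⟨g, hg⟩ := tf_ker D hu hd hv hw hQ hirr (C (C e) * s - C X) (by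
    simp only [_root_.map_sub, Derivation.leibniz, hs, hv, hD0, he, smul_eq_mul, C_mul]; ring)
  have hg0 := congrArg (eval 0) hg
  rw [tf_eval_zero] at hg0
  simp only [eval_sub, eval_mul, eval_C] at hg0
  set s0 := eval 0 s with hs0
  refine ⟨e, he, ?_, ?_⟩
  · apply IsRelPrime.isCoprime
    intro π hπc hπe
    obtain ⟨c1, rfl⟩ := hπc
    -- s0 - s0(-g(-Q)) divisible by π
    have h1 : C π ∣ s0 - s0.comp (-(g.comp (-Q))) := by
      have h2 : X - (-(g.comp (-Q))) ∣ s0.comp X - s0.comp (-(g.comp (-Q))) := by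
        have := sub_dvd_eval_sub (X : R[X]) (-(g.comp (-Q))) (s0.map C)
        simpa [comp, eval_map] using this
      rw [comp_X] at h2
      refine dvd_trans ?_ h2
      have : X - (-(g.comp (-Q))) = C e * s0 := by rw [← hg0]; ring
      rw [this]
      exact Dvd.dvd.mul_right (_root_.map_dvd C hπe) _
    obtain ⟨r, hr⟩ := h1
    set g2 : R[X] := g - C e * s0.comp (-g) with hg2
    have h3 : X + g2.comp (-Q) = C (e * π) * r := by
      have : g2.comp (-Q) = g.comp (-Q) - C e * s0.comp (-(g.comp (-Q))) := by
        rw [hg2, sub_comp, mul_comp, C_comp, comp_assoc, neg_comp]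
      rw [this, C_mul, mul_assoc, ← hr, ← hg0]; ring
    have h4 : C (C (e * π)) ∣ C X + eval₂ ((C : R[X] →+* R[X][X]).comp C)
        (C (C d) * X - C Q) g2 := by
      have h5 : (C (C d) * X - C Q) - (- C Q) ∣ eval₂ ((C : R[X] →+* R[X][X]).comp C)
        (C (C d) * X - C Q) g2 - C (g2.comp (-Q)) := by
        have := sub_dvd_eval_sub (C (C d) * X - C Q) (- C Q)
          (g2.map ((C : R[X] →+* R[X][X]).comp C))
        rw [eval_map, eval_map] at this
        have h6 : eval₂ ((C : R[X] →+* R[X][X]).comp C) (- C Q) g2 = C (g2.comp (-Q)) := by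
          rw [comp, hom_eval₂, C_neg]
        rwa [h6] at this
      have h7 : C (C (e * π)) ∣ (C (C d) * X - C Q) - (- C Q) := by
        refine ⟨C (C c1) * X, ?_⟩
        rw [he]; simp only [C_mul]; ring
      have h8 := h7.trans h5
      have h9 : (C (C (e * π)) : R[X][X]) ∣ C (X + g2.comp (-Q)) := by
        rw [h3]; exact _root_.map_dvd C (Dvd.intro _ rfl)
      have := dvd_add h9 h8
      rw [C_add] at this
      convert this using 1
      ring
    obtain ⟨s2, hs2⟩ := h4
    have hp : D (C (C d) * X - C Q) = 0 := by
      simp only [_root_.map_sub, Derivation.leibniz, hw, hD0, tf_D_C D hu hv, hQ, smul_eq_mul, C_mul]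
      ring
    have hDg : ∀ f : R[X], D (eval₂ ((C : R[X] →+* R[X][X]).comp C)
        (C (C d) * X - C Q) f) = 0 := by
      intro f
      induction f using Polynomial.induction_on' with
      | add a b ha hb => rw [eval₂_add, _root_.map_add, ha, hb, add_zero]
      | monomial n a =>
        rw [eval₂_monomial, RingHom.comp_apply, Derivation.leibniz, Derivation.leibniz_pow, hp, hD0]
        simp
    have hπ0 : π ≠ 0 := by rintro rfl; simp at hc0
    have h10 : D s2 = C (C c1) := by
      have := congrArg D hs2
      rw [_root_.map_add, hDg, hv, Derivation.leibniz, hD0, he] at this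
      simp only [smul_eq_mul, mul_zero, add_zero] at this
      have h11 : (C (C (e * π)) : R[X][X]) ≠ 0 := by simp [he0, hπ0]
      apply mul_left_cancel₀ h11
      rw [← this]; simp only [C_mul]; ring
    have h12 := hc2 s2 (by rw [h10, hD0])
    rw [h10] at h12
    obtain ⟨k, hk⟩ := hCC _ _ h12
    have hc10 : c1 ≠ 0 := by rintro rfl; simp at hc0
    apply IsUnit.of_mul_eq_one k
    apply mul_left_cancel₀ hc10
    rw [mul_one]; conv_rhs => rw [hk]
    ring
  · have := congrArg derivative hg0
    rw [derivative_comp, derivative_neg, hQ] at this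
    simp only [derivative_sub, derivative_mul, derivative_C, derivative_X, zero_mul, zero_add] at this
    refine ⟨derivative s0, (derivative g).comp (-Q), ?_⟩
    linear_combination this
end core

theorem tf_inj_of_surj {A : Type} [CommRing A] [IsNoetherianRing A] (f : A →+* A)
    (hf : Function.Surjective f) : Function.Injective f := by
  let I : ℕ →o Ideal A := ⟨fun n => RingHom.ker (f ^ n), by
    apply monotone_nat_of_le_succ
    intro n x hx
    rw [RingHom.mem_ker] at hx ⊢
    rw [pow_succ', RingHom.mul_def, RingHom.comp_apply, hx, map_zero]⟩
  obtain ⟨n, hn⟩ := monotone_stabilizes_iff_noetherian.2 (inferInstance : IsNoetherian A A) I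
  rw [injective_iff_map_eq_zero]
  intro x hx
  have hs : Function.Surjective (f ^ n : A →+* A) := by
    rw [RingHom.coe_pow]
    exact hf.iterate n
  obtain ⟨y, rfl⟩ := hs x
  have h1 : y ∈ I (n+1) := by
    change y ∈ RingHom.ker (f ^ (n+1))
    rw [RingHom.mem_ker, pow_succ', RingHom.mul_def, RingHom.comp_apply, hx]
  rw [← hn (n+1) (Nat.le_succ n)] at h1
  exact h1

/-- evaluation `K[u][v][w] → A`. -/
def tfEv {K : Type} [Field K] {A : Type} [CommRing A] [Algebra K A] (u v w : A) :
    Polynomial (Polynomial (Polynomial K)) →+* A :=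
  Polynomial.eval₂RingHom (Polynomial.eval₂RingHom (Polynomial.aeval (R := K) u).toRingHom v) w

section ev
open Polynomial
variable {K : Type} [Field K] {A : Type} [CommRing A] [Algebra K A] (u v w : A)

theorem tfEv_X : tfEv (K := K) u v w X = w := by simp [tfEv]
theorem tfEv_CX : tfEv (K := K) u v w (C X) = v := by simp [tfEv]
theorem tfEv_CC (r : K[X]) : tfEv (K := K) u v w (C (C r)) = aeval u r := by simp [tfEv]
end ev

theorem tfEv_bij {K : Type} [Field K] (u v w : PolyR K) (h : Algebra.adjoin K {u, v, w} = ⊤) :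
    Function.Bijective (tfEv (K := K) u v w) := by
  let a : PolyR K →ₐ[K] PolyR K := MvPolynomial.aeval ![u, v, w]
  have ha : Function.Surjective a := by
    rw [← AlgHom.range_eq_top, ← Algebra.adjoin_range_eq_range_aeval, ← h]
    congr 1
    ext x
    simp [eq_comm]
    tauto
  have ha' : Function.Bijective a := ⟨tf_inj_of_surj a.toRingHom ha, ha⟩
  let θ := tfEv (K := K) (MvPolynomial.X 0 : PolyR K) (MvPolynomial.X 1) (MvPolynomial.X 2)
  let ψ : PolyR K →ₐ[K] Polynomial (Polynomial (Polynomial K)) :=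
    MvPolynomial.aeval ![(Polynomial.C (Polynomial.C Polynomial.X) :
      Polynomial (Polynomial (Polynomial K))), Polynomial.C Polynomial.X, Polynomial.X]
  have h1 : ψ.toRingHom.comp θ = RingHom.id _ := by
    refine Polynomial.ringHom_ext' (Polynomial.ringHom_ext' (Polynomial.ringHom_ext' ?_ ?_) ?_) ?_
    · apply RingHom.ext; intro x
      simp only [RingHom.comp_apply, θ, tfEv_CC, Polynomial.aeval_C]
      exact ψ.commutes x
    · simp [θ, tfEv_CC, ψ]
    · simp [θ, tfEv_CX, ψ]
    · simp [θ, tfEv_X, ψ]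
  have h2 : θ.comp ψ.toRingHom = RingHom.id _ := by
    apply MvPolynomial.ringHom_ext
    · intro r
      have : ψ (MvPolynomial.C r) = Polynomial.C (Polynomial.C (Polynomial.C r)) := ψ.commutes r
      simp only [RingHom.comp_apply, AlgHom.toRingHom_eq_coe, RingHom.coe_coe, this, θ, tfEv_CC, Polynomial.aeval_C]
      rfl
    · intro i
      fin_cases i
      · simp [θ, tfEv_CC, ψ]
      · simp [θ, tfEv_CX, ψ]
      · simp [θ, tfEv_X, ψ]
  have hθ : Function.Bijective θ := by
    refine ⟨Function.LeftInverse.injective (g := ψ) fun x => ?_,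
      Function.RightInverse.surjective (g := ψ) fun x => ?_⟩
    · exact congrArg (fun f : _ →+* _ => f x) h1
    · exact congrArg (fun f : _ →+* _ => f x) h2
  have h3 : tfEv (K := K) u v w = a.toRingHom.comp θ := by
    refine Polynomial.ringHom_ext' (Polynomial.ringHom_ext' (Polynomial.ringHom_ext' ?_ ?_) ?_) ?_
    · ext1 x
      simp only [RingHom.comp_apply, θ, tfEv_CC, Polynomial.aeval_C]
      exact (a.commutes x).symm
    · simp [θ, tfEv_CC, a]
    · simp [θ, tfEv_CX, a]
    · simp [θ, tfEv_X, a]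
  rw [h3]
  exact ha'.comp hθ

theorem tf_transport {A B : Type} [CommRing A] [CommRing B] (f : B →+* A)
    (hf : Function.Bijective f) (X : Derivation ℤ A A) :
    ∃ D : Derivation ℤ B B, ∀ b, f (D b) = X (f b) := by
  let E : B ≃+* A := RingEquiv.ofBijective f hf
  have hE : ∀ b, E b = f b := fun _ => rfl
  refine ⟨Derivation.mk' ((E.symm.toAddMonoidHom.comp (X.toLinearMap.toAddMonoidHom.comp
    E.toAddMonoidHom)).toIntLinearMap) ?_, ?_⟩
  · intro a b
    simp
  · intro b
    exact E.apply_symm_apply _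

theorem tf_isUnit {A B : Type} [CommRing A] [CommRing B] (f : B →+* A)
    (hf : Function.Bijective f) (b : B) (h : IsUnit (f b)) : IsUnit b := by
  let E : B ≃+* A := RingEquiv.ofBijective f hf
  exact (MulEquiv.isUnit_map E).1 h

theorem tf_d_ne_zero {K : Type} [Field K] [CharZero K]
    (X : Derivation K (PolyR K) (PolyR K)) (hrk : rankD K X = 2)
    (u v w : PolyR K) (hsys : IsCoordSys K u v w) (hXu : X u = 0) : X v ≠ 0 := by
  intro hv
  have h2 : 2 ≤ corank K X := by
    apply le_csSup
    · refine ⟨3, ?_⟩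
      rintro r ⟨l, rfl, -, m, hm, -⟩
      rw [List.length_append] at hm
      omega
    · refine ⟨[u, v], rfl, ?_, [w], rfl, ?_⟩
      · simp [hXu, hv]
      · rw [← hsys.symm.symm]
        congr 1
        ext x
        simp
  unfold rankD at hrk
  omega

/-- For a rank-two irreducible triangulable locally nilpotent derivation written in a
triangular coordinate system `u,v,w` with `X u = 0`, `X v = d(u)`, `X w = q(u,v)`, and
with `c(u)` generating the plinth ideal, one has `d = c·e` with `gcd(c,e) = 1` and
`(e(u), q(u,v)) = (1)` in `K[u,v]`. -/
theorem triangular_form_factorization {K : Type} [Field K] [CharZero K]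
    (X : Derivation K (PolyR K) (PolyR K))
    (hln : LND K X) (hirr : IrredDer K X) (hrk : rankD K X = 2)
    (htri : Triangulable K X)
    (u v w : PolyR K) (hsys : IsCoordSys K u v w)
    (d : Polynomial K) (q : MvPolynomial (Fin 2) K)
    (hXu : X u = 0) (hXv : X v = Polynomial.aeval u d)
    (hXw : X w = MvPolynomial.aeval ![u, v] q)
    (c : Polynomial K) (hc : IsPlinthGen K X (Polynomial.aeval u c)) :
    ∃ e : Polynomial K, d = c * e ∧ IsCoprime c e ∧
      Ideal.span ({Polynomial.aeval (MvPolynomial.X 0 : MvPolynomial (Fin 2) K) e, q} :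
        Set (MvPolynomial (Fin 2) K)) = ⊤ := by
  have hbij := tfEv_bij u v w hsys
  let E : Polynomial (Polynomial (Polynomial K)) →+* PolyR K := tfEv (K := K) u v w
  have hEbij : Function.Bijective E := hbij
  obtain ⟨D, hD'⟩ := tf_transport (A := PolyR K) (B := Polynomial (Polynomial (Polynomial K))) E hEbij (X.restrictScalars ℤ)
  have hD : ∀ b, E (D b) = X (E b) := hD'
  let q' : Polynomial (Polynomial K) :=
    MvPolynomial.aeval ![Polynomial.C Polynomial.X, Polynomial.X] q
  have hq' : E (Polynomial.C q') = MvPolynomial.aeval ![u, v] q := by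
    have : (E.comp Polynomial.C).comp (MvPolynomial.aeval (R := K)
        ![(Polynomial.C Polynomial.X : Polynomial (Polynomial K)), Polynomial.X]).toRingHom =
        (MvPolynomial.aeval (R := K) ![u, v]).toRingHom := by
      apply MvPolynomial.ringHom_ext
      · intro r
        have h1 : (MvPolynomial.aeval (R := K)
          ![(Polynomial.C Polynomial.X : Polynomial (Polynomial K)), Polynomial.X])
            (MvPolynomial.C r) = Polynomial.C (Polynomial.C r) := AlgHom.commutes _ r
        have h2 := tfEv_CC u v w (Polynomial.C r)
        rw [Polynomial.aeval_C] at h2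
        simp only [RingHom.comp_apply, AlgHom.toRingHom_eq_coe, RingHom.coe_coe, h1,
          MvPolynomial.aeval_C]
        exact h2
      · intro i
        fin_cases i
        · have h2 := tfEv_CC (K := K) u v w Polynomial.X
          rw [Polynomial.aeval_X] at h2
          simpa using h2
        · have h2 := tfEv_CX (K := K) u v w
          simpa using h2
    exact congrArg (fun f : _ →+* _ => f q) this
  have hEX : E Polynomial.X = w := tfEv_X u v w
  have hECX : E (Polynomial.C Polynomial.X) = v := tfEv_CX u v w
  have hECC : ∀ r, E (Polynomial.C (Polynomial.C r)) = Polynomial.aeval u r := tfEv_CC u v w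
  have hXaev : ∀ r : Polynomial K, X (Polynomial.aeval u r) = 0 := by
    intro r
    rw [Derivation.map_aeval, hXu, smul_zero]
  have hDu : ∀ r, D (Polynomial.C (Polynomial.C r)) = 0 := by
    intro r
    apply hEbij.1
    rw [hD, hECC, hXaev, map_zero]
  have hDv : D (Polynomial.C Polynomial.X) = Polynomial.C (Polynomial.C d) := by
    apply hEbij.1
    rw [hD, hECX, hECC, hXv]
  have hDw : D Polynomial.X = Polynomial.C q' := by
    apply hEbij.1
    rw [hD, hEX, hq', hXw]
  have hd : d ≠ 0 := by
    rintro rfl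
    apply tf_d_ne_zero X hrk u v w hsys hXu
    rw [hXv, map_zero]
  have hirr' : ∀ π : Polynomial K, π ∣ d → Polynomial.C π ∣ q' → IsUnit π := by
    intro π h1 h2
    have hall : ∀ a, Polynomial.aeval u π ∣ X a := by
      intro a
      have ha : a ∈ Algebra.adjoin K {u, v, w} := by rw [show _ = _ from hsys]; trivial
      induction ha using Algebra.adjoin_induction with
      | mem x hx =>
        rcases hx with rfl | rfl | rfl
        · rw [hXu]; exact dvd_zero _
        · rw [hXv]; exact map_dvd _ h1
        · rw [hXw, ← hq', ← hECC]; exact map_dvd E (map_dvd Polynomial.C h2)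
      | algebraMap r => rw [Derivation.map_algebraMap]; exact dvd_zero _
      | add x y _ _ hx hy => rw [map_add]; exact dvd_add hx hy
      | mul x y _ _ hx hy =>
        rw [Derivation.leibniz]
        exact dvd_add (Dvd.dvd.mul_left hy _) (Dvd.dvd.mul_left hx _)
    have hun := hirr _ fun i => hall _
    rw [← hECC] at hun
    have hun2 : IsUnit (Polynomial.C (Polynomial.C π)) := tf_isUnit (A := PolyR K) (B := Polynomial (Polynomial (Polynomial K))) E hEbij _ hun
    exact Polynomial.isUnit_C.1 (Polynomial.isUnit_C.1 hun2)
  have hc' := Set.ext_iff.1 hc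
  have hc1 : ∃ s, D s = Polynomial.C (Polynomial.C c) := by
    obtain ⟨a, ha, -⟩ := (hc' (Polynomial.aeval u c)).2 ⟨1, by simp, by simp⟩
    obtain ⟨a, rfl⟩ := hEbij.2 a
    refine ⟨a, hEbij.1 ?_⟩
    rw [hD, ha, hECC]
  have hc2 : ∀ s, D (D s) = 0 → Polynomial.C (Polynomial.C c) ∣ D s := by
    intro s hs
    obtain ⟨r, -, hr⟩ := (hc' (X (E s))).1 ⟨E s, rfl, by rw [← hD, ← hD, hs, map_zero]⟩
    obtain ⟨r, rfl⟩ := hEbij.2 r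
    refine ⟨r, hEbij.1 ?_⟩
    rw [hD, hr, map_mul, hECC, mul_comm]
  obtain ⟨e, he, hce, heq⟩ := tf_core D hDu hd hDv hDw hirr' c hc1 hc2
  refine ⟨e, he, hce, ?_⟩
  let Θ : Polynomial (Polynomial K) →+* MvPolynomial (Fin 2) K :=
    Polynomial.eval₂RingHom (Polynomial.aeval (R := K) (MvPolynomial.X 0)).toRingHom
      (MvPolynomial.X 1)
  have hΘq : Θ q' = q := by
    have : Θ.comp (MvPolynomial.aeval (R := K)
        ![(Polynomial.C Polynomial.X : Polynomial (Polynomial K)), Polynomial.X]).toRingHom =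
        RingHom.id _ := by
      apply MvPolynomial.ringHom_ext
      · intro r
        have h1 : (MvPolynomial.aeval (R := K)
          ![(Polynomial.C Polynomial.X : Polynomial (Polynomial K)), Polynomial.X])
            (MvPolynomial.C r) = Polynomial.C (Polynomial.C r) := AlgHom.commutes _ r
        simp only [RingHom.comp_apply, AlgHom.toRingHom_eq_coe, RingHom.coe_coe, h1]
        simp [Θ]
      · intro i
        fin_cases i <;> simp [Θ]
    exact congrArg (fun f : _ →+* _ => f q) this
  have hfin := heq.map Θ
  rw [hΘq] at hfin
  have hΘe : Θ (Polynomial.C e) = Polynomial.aeval (MvPolynomial.X 0) e := by simp [Θ]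
  rw [hΘe] at hfin
  rw [Ideal.span_insert, ← Ideal.isCoprime_iff_sup_eq, Ideal.isCoprime_span_singleton_iff]
  exact hfin

end
end

section
/- Let K be a field of characteristic zero and X a rank-two irreducible triangulable locally nilpotent K-derivation of K[x,y,z]. Write K[x,y,z]^X = K[u,p] where u is a coordinate of K[x,y,z], let s be a minimal local slice of X, and write X(s) = c(u). Then there exist v,w ∈ K[x,y,z] such that u,v,w is a coordinate system of K[x,y,z] and X(u) = 0, X(v) = c(u), X(w) = q(u,v) for some q ∈ K[u,v]. -/
noncomputable section

variable (K : Type) [Field K] [CharZero K]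

namespace TriAux
open Polynomial

theorem antideriv {F A : Type*} [Field F] [CharZero F] [CommRing A] [Algebra F A] (g : A[X]) :
    ∃ G : A[X], derivative G = g := by
  induction g using Polynomial.induction_on' with
  | add p q hp hq =>
    obtain ⟨P, rfl⟩ := hp
    obtain ⟨Q, rfl⟩ := hq
    exact ⟨P + Q, by simp⟩
  | monomial n a =>
    refine ⟨monomial (n + 1) (algebraMap F A ((n + 1 : F)⁻¹) * a), ?_⟩
    rw [derivative_monomial]
    congr 1
    have h : ((n : F) + 1) ≠ 0 := by exact_mod_cast Nat.succ_ne_zero n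
    have h2 : algebraMap F A ((n + 1 : F)⁻¹) * ((n + 1 : ℕ) : A) = 1 := by
      have : ((n + 1 : ℕ) : A) = algebraMap F A (n + 1 : F) := by simp
      rw [this, ← map_mul, inv_mul_cancel₀ h, map_one]
    calc _ = (algebraMap F A ((n + 1 : F)⁻¹) * ((n + 1 : ℕ) : A)) * a := by ring
      _ = a := by rw [h2, one_mul]

variable {A : Type*} [CommRing A]

theorem CC_eq (a : A) : algebraMap A A[X][X] a = C (C a) := rfl

theorem aeval_CX (q : A[X]) : aeval (C X : A[X][X]) q = C q := by
  induction q using Polynomial.induction_on' with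
  | add p q hp hq => simp [hp, hq]
  | monomial n a => 
    rw [aeval_monomial, CC_eq, ← C_mul_X_pow_eq_monomial]; simp

theorem D_CC (D : Derivation A A[X][X] A[X][X]) (a : A) : D (C (C a)) = 0 :=
  D.map_algebraMap a

theorem D_aeval (D : Derivation A A[X][X] A[X][X]) (x : A[X][X]) (E : A[X]) :
    D (aeval x E) = aeval x (derivative E) * D x := by
  rw [Derivation.map_aeval, smul_eq_mul]

theorem D_C (D : Derivation A A[X][X] A[X][X]) {f : A} (hV : D (C X) = C (C f)) (q : A[X]) :
    D (C q) = C (C f * derivative q) := by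
  rw [← aeval_CX, D_aeval, hV, aeval_CX, ← C_mul, mul_comm]

theorem coeff_D (D : Derivation A A[X][X] A[X][X]) {f : A} {g : A[X]} (hV : D (C X) = C (C f))
    (hW : D X = C g) (x : A[X][X]) (n : ℕ) :
    (D x).coeff n = C f * derivative (x.coeff n) + (n + 1) * g * x.coeff (n + 1) := by
  induction x using Polynomial.induction_on' with
  | add p q hp hq => simp [hp, hq]; ring
  | monomial m a =>
    rw [← C_mul_X_pow_eq_monomial, D.leibniz, D.leibniz_pow, D_C D hV, hW]
    simp only [smul_eq_mul, nsmul_eq_mul]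
    cases m with
    | zero => 
      simp [coeff_C]
      split_ifs <;> simp
    | succ m =>
      have e : C a * (((m + 1 : ℕ) : A[X][X]) * (X ^ (m + 1 - 1) * C g))
          + X ^ (m + 1) * C (C f * derivative a)
          = C (a * ((m : A[X]) + 1) * g) * X ^ m + C (C f * derivative a) * X ^ (m + 1) := by
        simp; ring
      rw [e]
      simp only [coeff_add, coeff_C_mul, coeff_X_pow]
      by_cases h1 : n = m
      · subst h1; simp; ring
      · by_cases h2 : n = m + 1
        · subst h2; simp
        · simp [h1, h2]

/-- Reduction modulo `r`. -/
def red (r : A) : A[X][X] →+* (A ⧸ Ideal.span {r})[X][X] :=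
  mapRingHom (mapRingHom (Ideal.Quotient.mk (Ideal.span {r})))

theorem map_eq_zero_iff (r : A) (x : A[X]) :
    x.map (Ideal.Quotient.mk (Ideal.span {r})) = 0 ↔ C r ∣ x := by
  rw [C_dvd_iff_dvd_coeff, Polynomial.ext_iff]
  simp [Ideal.Quotient.eq_zero_iff_dvd]

theorem red_eq_zero_iff (r : A) (x : A[X][X]) : red r x = 0 ↔ C (C r) ∣ x := by
  rw [C_dvd_iff_dvd_coeff, Polynomial.ext_iff]
  simp [red, map_eq_zero_iff]

theorem red_C (r : A) (x : A[X]) :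
    red r (C x) = C (x.map (Ideal.Quotient.mk (Ideal.span {r}))) := by
  simp [red]

theorem red_aeval (r : A) (x : A[X][X]) (E : A[X]) :
    red r (aeval x E) = aeval (red r x) (E.map (Ideal.Quotient.mk (Ideal.span {r}))) := by
  rw [aeval_def, aeval_def, hom_eval₂, eval₂_map]
  congr 1
  ext a : 1
  simp [red]

theorem aeval_C_eq_comp (q E : A[X]) : aeval (C q : A[X][X]) E = C (E.comp q) := by
  rw [comp, ← aeval_CX (E.eval₂ C q), aeval_CX]
  induction E using Polynomial.induction_on' with
  | add p q hp hq => simp [hp, hq]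
  | monomial n a => simp

/-- Strong transcendence: dividing by primes of `f`. -/
def Trans (f : A) (x : A[X][X]) : Prop :=
  ∀ r : A, Prime r → r ∣ f → ∀ E : A[X], C (C r) ∣ aeval x E → C r ∣ E

theorem Trans.dvd [IsDomain A] [UniqueFactorizationMonoid A] {f : A} {x : A[X][X]} (h : Trans f x)
    (hf : f ≠ 0) (n : ℕ) :
    ∀ a : A, a ∣ f ^ n → ∀ E : A[X], C (C a) ∣ aeval x E → C a ∣ E := by
  intro a
  induction a using UniqueFactorizationMonoid.induction_on_prime with
  | h₁ => intro h0; exact absurd (zero_dvd_iff.mp h0) (pow_ne_zero _ hf)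
  | h₂ a ha => intro _ E _; exact (ha.map C).dvd
  | h₃ a p ha hp ih =>
    intro hd E hE
    have hpf : p ∣ f := hp.dvd_of_dvd_pow ((dvd_mul_right p a).trans hd)
    obtain ⟨z, hz⟩ := hE
    obtain ⟨E', rfl⟩ := h p hp hpf E ⟨C (C a) * z, by rw [hz]; simp; ring⟩
    have : C (C a) ∣ aeval x E' := by
      refine ⟨z, ?_⟩
      have hp' : (C (C p) : A[X][X]) ≠ 0 := by simpa using hp.ne_zero
      apply mul_left_cancel₀ hp'
      rw [map_mul, aeval_C, CC_eq] at hz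
      rw [hz]; simp; ring
    obtain ⟨E'', rfl⟩ := ih ((dvd_mul_left a p).trans hd) E' this
    exact ⟨E'', by simp; ring⟩

theorem trans_of_transcendental {f : A} {x : A[X][X]}
    (h : ∀ r : A, Prime r → r ∣ f → Transcendental (A ⧸ Ideal.span {r}) (red r x)) : Trans f x := by
  intro r hr hrf E hE
  rw [← red_eq_zero_iff, red_aeval] at hE
  rw [← map_eq_zero_iff]
  exact (transcendental_iff.mp (h r hr hrf)) _ hE

theorem transcendental_of_trans {f : A} {x : A[X][X]} (h : Trans f x) (r : A) (hr : Prime r)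
    (hf : r ∣ f) : Transcendental (A ⧸ Ideal.span {r}) (red r x) := by
  rw [transcendental_iff]
  intro p hp
  obtain ⟨E, rfl⟩ := Polynomial.map_surjective _ Ideal.Quotient.mk_surjective p
  rw [map_eq_zero_iff]
  rw [← red_aeval, red_eq_zero_iff] at hp
  exact h r hr hf E hp

/-- The generator of the kernel. -/
def PP (f : A) (G : A[X]) : A[X][X] := C (C f) * X - C G

def NonConst (f : A) (G : A[X]) : Prop :=
  ∀ r : A, Prime r → r ∣ f → (G.map (Ideal.Quotient.mk (Ideal.span {r}))).natDegree ≠ 0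

theorem red_PP {f : A} {G : A[X]} {r : A} (hrf : r ∣ f) :
    red r (PP f G) = C (- G.map (Ideal.Quotient.mk (Ideal.span {r}))) := by
  have : red r (C (C f)) = 0 := by
    rw [red_eq_zero_iff]; exact _root_.map_dvd C (_root_.map_dvd C hrf)
  rw [PP, map_sub, map_mul, this, red_C]; simp

theorem quot_dom {r : A} (hr : Prime r) : IsDomain (A ⧸ Ideal.span {r}) := by
  have : (Ideal.span {r}).IsPrime := (Ideal.span_singleton_prime hr.ne_zero).mpr hr
  infer_instance

theorem trans_PP {f : A} {G : A[X]} (h : NonConst f G) : Trans f (PP f G) := by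
  apply trans_of_transcendental
  intro r hr hrf
  have := quot_dom hr
  rw [transcendental_iff]
  intro E hE
  rw [red_PP hrf, aeval_C_eq_comp, C_eq_zero, comp_eq_zero_iff] at hE
  rcases hE with h0 | ⟨_, h1⟩
  · exact h0
  · exfalso
    apply h r hr hrf
    rw [← natDegree_neg, h1]; simp

theorem D_PP (D : Derivation A A[X][X] A[X][X]) {f : A} {G : A[X]} (hV : D (C X) = C (C f))
    (hW : D X = C (derivative G)) : D (PP f G) = 0 := by
  rw [PP, map_sub, D.leibniz, D_CC, D_C D hV, hW]
  simp

theorem D_aeval_PP (D : Derivation A A[X][X] A[X][X]) {f : A} {G : A[X]} (hV : D (C X) = C (C f))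
    (hW : D X = C (derivative G)) (E : A[X]) : D (aeval (PP f G) E) = 0 := by
  rw [D_aeval, D_PP D hV hW, mul_zero]

theorem natDegree_PP_le {f : A} {G : A[X]} : (PP f G).natDegree ≤ 1 := by
  unfold PP
  compute_degree

theorem coeff_PP {f : A} {G : A[X]} : (PP f G).coeff 1 = C f := by
  simp [PP, coeff_C]

theorem ker_aux [IsDomain A] [CharZero A]
    (D : Derivation A A[X][X] A[X][X]) {f : A} {G : A[X]} (hV : D (C X) = C (C f))
    (hW : D X = C (derivative G)) (hf : f ≠ 0) (n : ℕ) :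
    ∀ x : A[X][X], x.natDegree ≤ n → D x = 0 →
      ∃ (m : ℕ) (E : A[X]), C (C (f ^ m)) * x = aeval (PP f G) E := by
  induction n with
  | zero =>
    intro x hx hD
    have hc := coeff_D D hV hW x 0
    rw [hD, coeff_eq_zero_of_natDegree_lt (show x.natDegree < 0 + 1 by omega)] at hc
    simp [hf] at hc
    have := hc
    refine ⟨0, C ((x.coeff 0).coeff 0), ?_⟩
    rw [aeval_C, CC_eq, ← eq_C_of_natDegree_eq_zero this, ← eq_C_of_natDegree_eq_zero (by omega)]
    simp
  | succ n ih =>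
    intro x hx hD
    have hc := coeff_D D hV hW x (n + 1)
    rw [hD, coeff_eq_zero_of_natDegree_lt (show x.natDegree < (n + 1) + 1 by omega)] at hc
    simp [hf] at hc
    have := hc
    obtain ⟨a, ha⟩ : ∃ a, x.coeff (n + 1) = C a := ⟨_, eq_C_of_natDegree_eq_zero this⟩
    set P := PP f G with hP
    have hdeg : (C (C (f ^ (n + 1))) * x - C (C a) * P ^ (n + 1)).natDegree ≤ n := by
      rw [natDegree_le_iff_coeff_eq_zero]
      intro N hN
      have hPd : (P ^ (n + 1)).natDegree ≤ (n + 1) := by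
        simpa using natDegree_pow_le_of_le (n + 1) (natDegree_PP_le (f := f) (G := G))
      rcases Nat.lt_or_ge (n + 1) N with h | h
      · simp only [coeff_sub, coeff_C_mul]
        rw [coeff_eq_zero_of_natDegree_lt (lt_of_le_of_lt hx h),
          coeff_eq_zero_of_natDegree_lt (lt_of_le_of_lt hPd h)]
        simp
      · obtain rfl : N = n + 1 := by omega
        simp only [coeff_sub, coeff_C_mul]
        have := coeff_pow_of_natDegree_le (m := n + 1) (natDegree_PP_le (f := f) (G := G))
        rw [mul_one, coeff_PP] at this
        rw [ha, hP, this, ← C_pow, ← C_mul, ← C_mul]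
        ring_nf
    obtain ⟨m, E, hE⟩ := ih _ hdeg (by
      rw [map_sub, D.leibniz, D.leibniz, D.leibniz_pow, D_CC, D_CC, hD, hP, D_PP D hV hW]
      simp)
    refine ⟨m + (n + 1), E + C (f ^ m * a) * X ^ (n + 1), ?_⟩
    rw [map_add, ← hE, map_mul, aeval_C, CC_eq, map_pow (aeval P), aeval_X]
    simp only [C_mul, C_pow, pow_add]
    ring

theorem ker_D [IsDomain A] [UniqueFactorizationMonoid A] [CharZero A]
    (D : Derivation A A[X][X] A[X][X]) {f : A} {G : A[X]} (hV : D (C X) = C (C f))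
    (hW : D X = C (derivative G)) (hf : f ≠ 0) (hG : NonConst f G) (x : A[X][X]) (hx : D x = 0) :
    ∃ E : A[X], x = aeval (PP f G) E := by
  obtain ⟨m, E, hE⟩ := ker_aux D hV hW hf _ x le_rfl hx
  obtain ⟨E', rfl⟩ := (trans_PP hG).dvd hf m (f ^ m) dvd_rfl E ⟨x, hE.symm⟩
  refine ⟨E', ?_⟩
  have hp' : (C (C (f ^ m)) : A[X][X]) ≠ 0 := by simpa using fun h => absurd h hf
  apply mul_left_cancel₀ hp'
  rw [hE, map_mul, aeval_C, CC_eq]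

end TriAux

namespace TriAux
open Polynomial
variable {A : Type*} [CommRing A]

theorem comp_dvd {k : Type*} [Field k] {γ B H : k[X]} (hγ : γ.natDegree ≠ 0) (hB : B ≠ 0)
    (h : B.comp γ ∣ H.comp γ) : B ∣ H := by
  have hdm := EuclideanDomain.mod_add_div H B
  have hr : (H % B).comp γ = 0 := by
    by_contra hne
    have h1 : B.comp γ ∣ (H % B).comp γ := by
      have : (H % B).comp γ = H.comp γ - B.comp γ * (H / B).comp γ := by
        have h7 := congrArg (fun p => p.comp γ) hdm
        simp only [add_comp, mul_comp] at h7
        rw [← h7]; ring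
      rw [this]
      exact dvd_sub h (dvd_mul_right _ _)
    have h2 := natDegree_le_of_dvd h1 hne
    rw [natDegree_comp, natDegree_comp] at h2
    have h3 : H % B ≠ 0 := by rintro h0; exact hne (by rw [h0, zero_comp])
    have h4 : B.natDegree ≤ (H % B).natDegree :=
      Nat.le_of_mul_le_mul_right h2 (Nat.pos_of_ne_zero hγ)
    have h5 : (H % B).degree < B.degree := EuclideanDomain.mod_lt H hB
    have := natDegree_lt_natDegree h3 h5
    omega
  rw [comp_eq_zero_iff] at hr
  rcases hr with h0 | ⟨_, h1⟩
  · exact EuclideanDomain.mod_eq_zero.mp h0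
  · exact absurd (by rw [h1]; simp) hγ

theorem quot_max [IsDomain A] [IsPrincipalIdealRing A] {r : A} (hr : Prime r) :
    (Ideal.span {r}).IsMaximal :=
  PrincipalIdealRing.isMaximal_of_irreducible hr.irreducible

theorem improve [IsDomain A] [IsPrincipalIdealRing A] [CharZero A]
    (D : Derivation A A[X][X] A[X][X]) {f : A} {G : A[X]} (hV : D (C X) = C (C f))
    (hW : D X = C (derivative G)) (hf : f ≠ 0) (hG : NonConst f G)
    {r f1 : A} (hr : Prime r) (hrf : r * f1 ∣ f) {t s b : A[X][X]} (ht : D t = C (C (r * f1)))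
    (hs : D s = b) (hb : D b = 0) (hrb : ¬ C (C r) ∣ b) : ∃ t', D t' = C (C f1) := by
  have hrf' : r ∣ f := (dvd_mul_right r f1).trans hrf
  obtain ⟨B, hB⟩ := ker_D D hV hW hf hG b hb
  obtain ⟨H, hH⟩ := ker_D D hV hW hf hG (C (C (r * f1)) * s - b * t) (by
    rw [map_sub, D.leibniz, D.leibniz, D_CC, hs, hb, ht]; simp; ring)
  let := @Ideal.Quotient.field A _ (Ideal.span {r}) (quot_max hr)
  set φ := Ideal.Quotient.mk (Ideal.span {r}) with hφ
  have hrB : red r b ≠ 0 := by rwa [Ne, red_eq_zero_iff]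
  have h1 : red r b = C ((B.map φ).comp (-G.map φ)) := by
    rw [hB, red_aeval, red_PP hrf', aeval_C_eq_comp]
  have h2 : - (red r b * red r t) = C ((H.map φ).comp (-G.map φ)) := by
    rw [← aeval_C_eq_comp, ← red_PP hrf', ← red_aeval, ← hH, map_sub, map_mul (red r), map_mul (red r)]
    have : red r (C (C (r * f1))) = 0 := by
      rw [red_eq_zero_iff]; exact _root_.map_dvd C (_root_.map_dvd C (dvd_mul_right _ _))
    rw [this]; ring
  have h3 : (red r t).natDegree = 0 := by
    by_cases h0 : red r t = 0
    · rw [h0]; simp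
    have h4 := congrArg natDegree h2
    rw [natDegree_neg, natDegree_mul hrB h0, natDegree_C] at h4
    omega
  obtain ⟨t0, ht0⟩ : ∃ t0, red r t = C t0 := ⟨_, eq_C_of_natDegree_eq_zero h3⟩
  have hne : (-G.map φ).natDegree ≠ 0 := by rw [natDegree_neg]; exact hG r hr hrf'
  rw [ht0, h1, ← C_mul, ← C_neg, C_inj] at h2
  have hB0 : B.map φ ≠ 0 := by
    intro h0; apply hrB; rw [h1, h0]; simp
  obtain ⟨q, hq⟩ : B.map φ ∣ H.map φ := comp_dvd hne hB0 ⟨-t0, by rw [← h2]; ring⟩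
  have hc : (B.map φ).comp (-G.map φ) ≠ 0 := by
    intro h0; apply hrB; rw [h1, h0]; simp
  have hqt : t0 = (-q).comp (-G.map φ) := by
    rw [hq, mul_comp] at h2
    rw [neg_comp]
    apply mul_left_cancel₀ hc
    linear_combination -h2
  obtain ⟨Q, hQ⟩ := Polynomial.map_surjective φ Ideal.Quotient.mk_surjective (-q)
  have h5 : red r (t - aeval (PP f G) Q) = 0 := by
    rw [map_sub, ht0, red_aeval, red_PP hrf', aeval_C_eq_comp, ← hφ, hQ, ← hqt, sub_self]
  rw [red_eq_zero_iff] at h5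
  obtain ⟨t', ht'⟩ := h5
  refine ⟨t', ?_⟩
  have h6 := congrArg D ht'
  rw [map_sub, D_aeval_PP D hV hW, ht, D.leibniz, D_CC] at h6
  have hr0 : (C (C r) : A[X][X]) ≠ 0 := by simpa using hr.ne_zero
  apply mul_left_cancel₀ hr0
  simp only [smul_eq_mul, smul_zero, mul_zero, add_zero, sub_zero] at h6
  rw [← h6]; simp

theorem improve_all [IsDomain A] [IsPrincipalIdealRing A] [CharZero A]
    (D : Derivation A A[X][X] A[X][X]) {f : A} {G : A[X]} (hV : D (C X) = C (C f))
    (hW : D X = C (derivative G)) (hf : f ≠ 0) (hG : NonConst f G)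
    {s b : A[X][X]} (hs : D s = b) (hb : D b = 0) (f1 : A) :
    f1 ∣ f → (∃ t, D t = C (C f1)) →
    (∃ t, D t = 1) ∨ ∃ r : A, Prime r ∧ C (C r) ∣ b := by
  induction f1 using UniqueFactorizationMonoid.induction_on_prime with
  | h₁ => intro h0; exact absurd (zero_dvd_iff.mp h0) hf
  | h₂ a ha =>
    rintro - ⟨t, ht⟩
    left
    obtain ⟨a', rfl⟩ := ha
    refine ⟨C (C ((a'⁻¹ : Aˣ) : A)) * t, ?_⟩
    rw [D.leibniz, D_CC, ht]
    simp [← C_mul]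
  | h₃ a p ha hp ih =>
    rintro hd ⟨t, ht⟩
    by_cases h : C (C p) ∣ b
    · exact Or.inr ⟨p, hp, h⟩
    · exact ih ((dvd_mul_left a p).trans hd) (improve D hV hW hf hG hp hd ht hs hb h)

theorem taylor (M : Subalgebra A A[X][X]) (E : A[X]) {x y z r : A[X][X]} (hx : x ∈ M) (hy : y ∈ M)
    (hz : z ∈ M) (h : x = y + r * z) : ∃ d ∈ M, aeval x E = aeval y E + r * d := by
  obtain ⟨q, hq⟩ := sub_dvd_eval_sub (⟨x, hx⟩ : M) (⟨y, hy⟩ : M) (E.map (algebraMap A M))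
  have h2 := congrArg (fun m : M => (m : A[X][X])) hq
  simp only [eval_map_algebraMap, AddSubgroupClass.coe_sub, MulMemClass.coe_mul,
    ← Subalgebra.aeval_coe] at h2
  refine ⟨z * q, M.mul_mem hz q.2, ?_⟩
  linear_combination h2 + q * h

theorem spread {v p : A[X][X]} (r : A) (N : A[X][X])
    (h : ∃ c ∈ Algebra.adjoin A {v}, ∃ d ∈ Algebra.adjoin A {v, p}, ∃ z,
      p = c + C (C r) * d + N * z) (x : A[X][X]) (hx : x ∈ Algebra.adjoin A {v, p}) :
    ∃ c ∈ Algebra.adjoin A {v}, ∃ d ∈ Algebra.adjoin A {v, p}, ∃ z,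
      x = c + C (C r) * d + N * z := by
  have hle : Algebra.adjoin A {v} ≤ Algebra.adjoin A {v, p} := Algebra.adjoin_mono (by simp)
  have hr : C (C r) ∈ Algebra.adjoin A {v, p} := (Algebra.adjoin A {v, p}).algebraMap_mem r
  induction hx using Algebra.adjoin_induction with
  | mem x hx =>
    rcases hx with rfl | rfl
    · exact ⟨x, Algebra.subset_adjoin rfl, 0, zero_mem _, 0, by simp⟩
    · exact h
  | algebraMap a => exact ⟨_, Subalgebra.algebraMap_mem _ a, 0, zero_mem _, 0, by simp⟩
  | add x y _ _ hx hy =>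
    obtain ⟨c, hc, d, hd, z, rfl⟩ := hx
    obtain ⟨c', hc', d', hd', z', rfl⟩ := hy
    exact ⟨c + c', add_mem hc hc', d + d', add_mem hd hd', z + z', by ring⟩
  | mul x y _ _ hx hy =>
    obtain ⟨c, hc, d, hd, z, rfl⟩ := hx
    obtain ⟨c', hc', d', hd', z', rfl⟩ := hy
    exact ⟨c * c', mul_mem hc hc', c * d' + d * c' + C (C r) * (d * d'),
      add_mem (add_mem (mul_mem (hle hc) hd') (mul_mem hd (hle hc'))) (mul_mem hr (mul_mem hd hd')),
      z * (c' + C (C r) * d' + N * z') + (c + C (C r) * d) * z', by ring⟩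

theorem spread_pow {v p : A[X][X]} (r : A) (N : A[X][X])
    (h : ∀ x ∈ Algebra.adjoin A {v, p}, ∃ c ∈ Algebra.adjoin A {v},
      ∃ d ∈ Algebra.adjoin A {v, p}, ∃ z, x = c + C (C r) * d + N * z) (k : ℕ) :
    ∀ x ∈ Algebra.adjoin A {v, p}, ∃ c ∈ Algebra.adjoin A {v},
      ∃ d ∈ Algebra.adjoin A {v, p}, ∃ z, x = c + C (C (r ^ k)) * d + N * z := by
  induction k with
  | zero => intro x hx; exact ⟨0, zero_mem _, x, hx, 0, by simp⟩
  | succ k ih =>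
    intro x hx
    obtain ⟨c, hc, d, hd, z, rfl⟩ := ih x hx
    obtain ⟨c', hc', d', hd', z', rfl⟩ := h d hd
    refine ⟨c + C (C (r ^ k)) * c', add_mem hc (mul_mem (Subalgebra.algebraMap_mem _ (r ^ k)) hc'),
      d', hd', z + C (C (r ^ k)) * z', ?_⟩
    simp only [pow_succ, C_mul]; ring

theorem spread_E {v p w : A[X][X]} {c : A[X][X]} (N : A) (hc : c ∈ Algebra.adjoin A {v})
    (h : p = c + C (C N) * w) (x : A[X][X]) (hx : x ∈ Algebra.adjoin A {v, p}) :
    ∃ c ∈ Algebra.adjoin A {v}, ∃ e ∈ Algebra.adjoin A {v, w}, x = c + C (C N) * e := by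
  have hle : Algebra.adjoin A {v} ≤ Algebra.adjoin A {v, w} := Algebra.adjoin_mono (by simp)
  have hN : C (C N) ∈ Algebra.adjoin A {v, w} := (Algebra.adjoin A {v, w}).algebraMap_mem N
  induction hx using Algebra.adjoin_induction with
  | mem x hx =>
    rcases hx with rfl | rfl
    · exact ⟨x, Algebra.subset_adjoin rfl, 0, zero_mem _, by simp⟩
    · exact ⟨c, hc, w, Algebra.subset_adjoin (by simp), h⟩
  | algebraMap a => exact ⟨_, Subalgebra.algebraMap_mem _ a, 0, zero_mem _, by simp⟩
  | add x y _ _ hx hy =>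
    obtain ⟨c, hc, d, hd, rfl⟩ := hx
    obtain ⟨c', hc', d', hd', rfl⟩ := hy
    exact ⟨c + c', add_mem hc hc', d + d', add_mem hd hd', by ring⟩
  | mul x y _ _ hx hy =>
    obtain ⟨c, hc, d, hd, rfl⟩ := hx
    obtain ⟨c', hc', d', hd', rfl⟩ := hy
    exact ⟨c * c', mul_mem hc hc', c * d' + d * c' + C (C N) * (d * d'),
      add_mem (add_mem (mul_mem (hle hc) hd') (mul_mem hd (hle hc'))) (mul_mem hN (mul_mem hd hd')),
      by ring⟩

theorem endo_inj {R : Type*} [CommRing R] [IsNoetherianRing R] (σ : R →+* R)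
    (h : Function.Surjective σ) : Function.Injective σ := by
  have hmono : Monotone (fun n : ℕ => RingHom.ker (σ ^ n)) := by
    apply monotone_nat_of_le_succ
    intro n x hx
    rw [RingHom.mem_ker] at hx ⊢
    rw [pow_succ', RingHom.mul_def, RingHom.comp_apply, hx, map_zero]
  obtain ⟨n, hn⟩ := monotone_stabilizes_iff_noetherian.mpr (inferInstance : IsNoetherian R R)
    ⟨_, hmono⟩
  have hsur : ∀ n : ℕ, Function.Surjective (σ ^ n : R →+* R) := by
    intro n
    induction n with
    | zero => intro x; exact ⟨x, rfl⟩
    | succ n ih => rw [pow_succ', RingHom.mul_def, RingHom.coe_comp]; exact h.comp ih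
  rw [injective_iff_map_eq_zero]
  intro x hx
  obtain ⟨y, rfl⟩ := hsur n x
  have h1 : y ∈ RingHom.ker (σ ^ (n + 1)) := by
    rw [RingHom.mem_ker, pow_succ', RingHom.mul_def, RingHom.comp_apply, hx]
  have h2 : RingHom.ker (σ ^ n) = RingHom.ker (σ ^ (n + 1)) := hn (n + 1) (by omega)
  rw [← h2] at h1
  exact h1

end TriAux

namespace TriAux
open Polynomial
variable {A : Type*} [CommRing A]

theorem aeval_mem' (M : Subalgebra A A[X][X]) (E : A[X]) {x : A[X][X]} (hx : x ∈ M) :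
    aeval x E ∈ M := by
  have := (aeval (⟨x, hx⟩ : M) E).2
  rwa [← Subalgebra.aeval_coe] at this

theorem linear_mod [IsDomain A] [IsPrincipalIdealRing A] [CharZero A]
    (D : Derivation A A[X][X] A[X][X]) {r N : A} {G : A[X]} (hV : D (C X) = C (C (r * N)))
    (hW : D X = C (derivative G)) (hN : N ≠ 0) (hr : Prime r) (hG : NonConst (r * N) G)
    {t : A[X][X]} (ht : D t = C (C N)) :
    ∃ (a b : A) (G1 : A[X]), G = C b + C a * X + C r * G1 ∧ ¬ r ∣ a := by
  have hf : r * N ≠ 0 := mul_ne_zero hr.ne_zero hN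
  have hrf : r ∣ r * N := dvd_mul_right _ _
  obtain ⟨E, hE⟩ := ker_D D hV hW hf hG (C X - C (C r) * t) (by
    rw [map_sub, D.leibniz, D_CC, hV, ht]; simp)
  have := quot_dom hr
  set φ := Ideal.Quotient.mk (Ideal.span {r}) with hφ
  have h1 := congrArg (red r) hE
  have h0 : red r (C (C r)) = 0 := by rw [red_eq_zero_iff]
  rw [map_sub, map_mul, h0, red_aeval, red_PP hrf, aeval_C_eq_comp, red_C, map_X, zero_mul,
    sub_zero, C_inj] at h1
  have h2 := congrArg natDegree h1
  rw [natDegree_comp, natDegree_X, natDegree_neg] at h2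
  have h3 : (G.map φ).natDegree = 1 := Nat.eq_one_of_mul_eq_one_left h2.symm
  have h4 := eq_X_add_C_of_natDegree_le_one h3.le
  have h5 : C r ∣ G - (C (G.coeff 0) + C (G.coeff 1) * X) := by
    rw [← map_eq_zero_iff, ← hφ, Polynomial.map_sub, h4]
    simp
    ring
  obtain ⟨G1, hG1⟩ := h5
  refine ⟨G.coeff 1, G.coeff 0, G1, by rw [← hG1]; ring, ?_⟩
  intro hd
  have h6 : (G.map φ).coeff 1 = 0 := by
    rw [coeff_map, hφ, Ideal.Quotient.eq_zero_iff_dvd]; exact hd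
  rw [← h3] at h6
  have := leadingCoeff_eq_zero.mp h6
  rw [this] at h3
  simp at h3

set_option maxHeartbeats 1000000 in
theorem step [IsDomain A] [IsPrincipalIdealRing A] [CharZero A]
    (D : Derivation A A[X][X] A[X][X]) {r N : A} {G : A[X]} (hV : D (C X) = C (C (r * N)))
    (hW : D X = C (derivative G)) (hN : N ≠ 0) (hr : Prime r) (hG : NonConst (r * N) G)
    {t : A[X][X]} (ht : D t = C (C N)) :
    ∃ (v w : A[X][X]) (G2 : A[X]), Algebra.adjoin A {v, w} = ⊤ ∧ D v = C (C N) ∧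
      D w = aeval v (derivative G2) ∧ NonConst N G2 := by
  obtain ⟨a, b, G1, hG1, hra⟩ := linear_mod D hV hW hN hr hG ht
  have hf : r * N ≠ 0 := mul_ne_zero hr.ne_zero hN
  obtain ⟨m, hkm, hm⟩ := (FiniteMultiplicity.of_prime_left hr hf).exists_eq_pow_mul_and_not_dvd
  generalize multiplicity r (r * N) = k at hkm
  have hcop : IsCoprime r (a * m) :=
    hr.irreducible.coprime_iff_not_dvd.mpr (hr.not_dvd_mul hra hm)
  obtain ⟨β, y0, hbez⟩ := hcop
  have hone : (C (C a) : A[X][X]) * (C (C m) * C (C y0)) + C (C r) * C (C β) = 1 := by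
    rw [← C_1, ← C_1, ← hbez]; simp only [C_mul, C_add]; ring
  set V : A[X][X] := C X with hVd
  set P := PP (r * N) G with hP
  set g1 : A[X][X] := aeval V G1 with hg1
  have hg1' : g1 = C G1 := aeval_CX G1
  set y : A[X][X] := C (C N) * X - g1 with hy
  set p : A[X][X] := P + C (C b) with hpd
  have hp : p = - C (C a) * V + C (C r) * y := by
    rw [hpd, hP, PP, hG1, hy, hg1', hVd]; simp only [C_mul, C_add]; ring
  set S0 : A[X][X] := C (C β) * V + C (C m) * C (C y0) * y with hS0
  have hVeq : V = C (C r) * S0 - C (C m) * C (C y0) * p := by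
    rw [hp, hS0]; linear_combination (-V) * hone
  have hyeq : y = C (C a) * S0 + C (C β) * p := by
    rw [hp, hS0]; linear_combination (-y) * hone
  set γ : A[X][X] := aeval (- (C (C m) * C (C y0)) * p) G1 with hγ
  set q : A[X][X] := (1 + C (C β)) * p + γ with hq
  set v : A[X][X] := S0 + C (C m) * C (C y0) * q with hv
  have hS0v : S0 = v - C (C m) * C (C y0) * q := by rw [hv]; ring
  set D0 := Algebra.adjoin A {v, p} with hD0
  have hvC : v ∈ Algebra.adjoin A {v} := Algebra.subset_adjoin rfl
  have hvD : v ∈ D0 := Algebra.subset_adjoin (by simp)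
  have hpD : p ∈ D0 := Algebra.subset_adjoin (by simp)
  have hcD : ∀ a : A, (C (C a) : A[X][X]) ∈ D0 := fun a => D0.algebraMap_mem a
  have hcC : ∀ a : A, (C (C a) : A[X][X]) ∈ Algebra.adjoin A {v} :=
    fun a => Subalgebra.algebraMap_mem _ a
  have hmpD : - (C (C m) * C (C y0)) * p ∈ D0 :=
    mul_mem (neg_mem (mul_mem (hcD _) (hcD _))) hpD
  have hγD : γ ∈ D0 := aeval_mem' D0 _ hmpD
  have hqD : q ∈ D0 := add_mem (mul_mem (add_mem (one_mem _) (hcD _)) hpD) hγD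
  have hS0D : S0 ∈ D0 := by
    rw [hS0v]; exact sub_mem hvD (mul_mem (mul_mem (hcD _) (hcD _)) hqD)
  have hVD : V ∈ D0 := by
    rw [hVeq]; exact sub_mem (mul_mem (hcD _) hS0D) (mul_mem (mul_mem (hcD _) (hcD _)) hpD)
  have hyD : y ∈ D0 := by
    rw [hyeq]; exact add_mem (mul_mem (hcD _) hS0D) (mul_mem (hcD _) hpD)
  have hNW : C (C N) * X = y + g1 := by rw [hy]; ring
  -- modulo `r`
  obtain ⟨d1, hd1, ht1⟩ := taylor D0 G1 hVD hmpD hS0D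
    (show V = - (C (C m) * C (C y0)) * p + C (C r) * S0 by rw [hVeq]; ring)
  have hmodr := spread (v := v) (p := p) r (C (C N))
    ⟨C (C a) * v, mul_mem (hcC _) hvC, C (C β) * q + d1,
      add_mem (mul_mem (hcD _) hqD) hd1, -X, by
        have e1 : C (C N) * X = C (C a) * (v - C (C m) * C (C y0) * q) + C (C β) * p
            + (γ + C (C r) * d1) := by rw [hNW, hyeq, hg1, ht1, ← hγ, hS0v]
        linear_combination e1 - q * hone - hq⟩
  -- modulo `m`
  have hrv : C (C r) * v ∈ D0 := mul_mem (hcD _) hvD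
  obtain ⟨d2, hd2, ht2⟩ := taylor D0 G1 (z := - C (C r) * C (C y0) * q - C (C y0) * p)
    (r := C (C m)) hVD hrv
    (sub_mem (mul_mem (mul_mem (neg_mem (hcD _)) (hcD _)) hqD) (mul_mem (hcD _) hpD))
    (by rw [hVeq, hS0v]; ring)
  have hmodm := spread (v := v) (p := p) m (C (C N))
    ⟨-(C (C r) * C (C a) * v + C (C r) * aeval (C (C r) * v) G1),
      neg_mem (add_mem (mul_mem (mul_mem (hcC _) (hcC _)) hvC) (mul_mem (hcC _)
        (aeval_mem' _ _ (mul_mem (hcC _) hvC)))),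
      C (C a) * C (C y0) * p - C (C r) * d2 + C (C r) * C (C a) * C (C y0) * q,
      add_mem (sub_mem (mul_mem (mul_mem (hcD _) (hcD _)) hpD) (mul_mem (hcD _) hd2))
        (mul_mem (mul_mem (mul_mem (hcD _) (hcD _)) (hcD _)) hqD), C (C r) * X, by
        have e1 : C (C N) * X = C (C a) * (v - C (C m) * C (C y0) * q) + C (C β) * p
            + (aeval (C (C r) * v) G1 + C (C m) * d2) := by rw [hNW, hyeq, hg1, ht2, hS0v]
        linear_combination (-C (C r)) * e1 - p * hone⟩
  -- combine
  obtain ⟨c, hc, w, hpw⟩ : ∃ c ∈ Algebra.adjoin A {v}, ∃ w, p = c + C (C N) * w := by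
    obtain ⟨c, hc, d, hd, z, h1⟩ := spread_pow r (C (C N)) hmodr k p hpD
    obtain ⟨c', hc', d', hd', z', h2⟩ := hmodm d hd
    refine ⟨c + C (C (r ^ k)) * c', add_mem hc (mul_mem (hcC _) hc'),
      C (C r) * d' + z + C (C (r ^ k)) * z', ?_⟩
    have h3 : (C (C r) * C (C N) : A[X][X]) = C (C (r ^ k)) * C (C m) := by
      rw [← C_mul, ← C_mul, ← C_mul, ← C_mul, hkm]
    rw [h2] at h1
    linear_combination h1 - d' * h3
  obtain ⟨L, hL⟩ : ∃ L : A[X], aeval v L = c := by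
    rw [Algebra.adjoin_singleton_eq_range_aeval] at hc; exact hc
  have hN0 : (C (C N) : A[X][X]) ≠ 0 := by simpa using hN
  have hr0 : (C (C r) : A[X][X]) ≠ 0 := by simpa using hr.ne_zero
  -- derivatives
  have hDp : D p = 0 := by rw [hpd, map_add, D_CC, hP, D_PP D hV hW, add_zero]
  have hDy : D y = C (C a) * C (C N) := by
    have h1 := congrArg D hp
    rw [hDp, map_add, D.leibniz, D.leibniz, map_neg, D_CC, D_CC, hV] at h1
    apply mul_left_cancel₀ hr0
    simp only [smul_eq_mul, C_mul, neg_zero, mul_zero, add_zero] at h1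
    linear_combination -h1
  have hDγ : D γ = 0 := by
    rw [hγ, D_aeval, D.leibniz, hDp, map_neg, D.leibniz, D_CC, D_CC]; simp
  have hDq : D q = 0 := by
    rw [hq, map_add, D.leibniz, hDp, map_add, D.map_one_eq_zero, D_CC, hDγ]; simp
  have hDv : D v = C (C N) := by
    rw [hv, map_add, D.leibniz, D.leibniz, hDq, D_CC, D_CC, hS0, map_add, D.leibniz, D.leibniz,
      D.leibniz, D_CC, D_CC, D_CC, hV, hDy]
    simp only [smul_eq_mul, C_mul, mul_zero, add_zero]
    linear_combination (C (C N)) * hone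
  have hDw : D w = aeval v (derivative (-L)) := by
    have h1 := congrArg D hpw
    rw [hDp, ← hL, map_add, D_aeval, hDv, D.leibniz, D_CC] at h1
    apply mul_left_cancel₀ hN0
    simp only [smul_eq_mul, mul_zero, add_zero] at h1
    rw [derivative_neg, map_neg]
    linear_combination -h1
  -- reduction of `p` modulo primes dividing `N`
  have hredp : ∀ s : A, Prime s → s ∣ N → red s p = C (- G.map (Ideal.Quotient.mk (Ideal.span {s}))
      + C (Ideal.Quotient.mk (Ideal.span {s}) b)) := by
    intro s hs hsN
    rw [hpd, map_add, hP, red_PP (hsN.mul_left r), red_C]; simp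
  have hredp' : ∀ s : A, Prime s → s ∣ N → red s p =
      aeval (red s v) (L.map (Ideal.Quotient.mk (Ideal.span {s}))) := by
    intro s hs hsN
    have : red s (C (C N)) = 0 := by
      rw [red_eq_zero_iff]; exact _root_.map_dvd C (_root_.map_dvd C hsN)
    rw [hpw, map_add, map_mul, this, ← hL, red_aeval]; simp
  have hnd : ∀ s : A, Prime s → s ∣ N → (- G.map (Ideal.Quotient.mk (Ideal.span {s}))
      + C (Ideal.Quotient.mk (Ideal.span {s}) b)).natDegree ≠ 0 := by
    intro s hs hsN
    rw [natDegree_add_C, natDegree_neg]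
    exact hG s hs (hsN.mul_left r)
  have htr : Trans N v := by
    apply trans_of_transcendental
    intro s hs hsN
    let := @Ideal.Quotient.field A _ (Ideal.span {s}) (quot_max hs)
    have h1 : Transcendental (A ⧸ Ideal.span {s}) (red s p) := by
      rw [transcendental_iff]
      intro E hE
      rw [hredp s hs hsN, aeval_C_eq_comp, C_eq_zero, comp_eq_zero_iff] at hE
      rcases hE with h0 | ⟨_, h1⟩
      · exact h0
      · exact absurd (by rw [h1]; simp) (hnd s hs hsN)
    rw [hredp' s hs hsN] at h1
    exact (transcendental_aeval_iff.mp h1).1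
  refine ⟨v, w, -L, ?_, hDv, hDw, ?_⟩
  · set E0 := Algebra.adjoin A {v, w} with hE0
    have hvE : v ∈ E0 := Algebra.subset_adjoin (by simp)
    have hwE : w ∈ E0 := Algebra.subset_adjoin (by simp)
    have hle : Algebra.adjoin A {v} ≤ E0 := Algebra.adjoin_mono (by simp)
    have hpE : p ∈ E0 := by
      rw [hpw]; exact add_mem (hle hc) (mul_mem (E0.algebraMap_mem N) hwE)
    have hDE : D0 ≤ E0 := by
      rw [hD0, Algebra.adjoin_le_iff]
      rintro x (rfl | rfl)
      · exact hvE
      · exact hpE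
    have hWE : (X : A[X][X]) ∈ E0 := by
      obtain ⟨c', hc', e, he, h1⟩ := spread_E N hc hpw (y + g1) (add_mem hyD (aeval_mem' _ _ hVD))
      obtain ⟨M, hM⟩ : ∃ M : A[X], aeval v M = c' := by
        rw [Algebra.adjoin_singleton_eq_range_aeval] at hc'; exact hc'
      rw [← hNW] at h1
      obtain ⟨M', rfl⟩ := htr.dvd hN 1 N (by simp) M ⟨X - e, by rw [hM]; linear_combination -h1⟩
      have : (X : A[X][X]) = aeval v M' + e := by
        apply mul_left_cancel₀ hN0
        rw [h1, ← hM, map_mul, aeval_C, CC_eq]; ring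
      rw [this]
      exact add_mem (hle (aeval_mem' _ _ hvC)) he
    rw [eq_top_iff]
    intro x _
    induction x using Polynomial.induction_on' with
    | add x z hx hz => exact add_mem (hx trivial) (hz trivial)
    | monomial n c =>
      rw [← C_mul_X_pow_eq_monomial, ← aeval_CX]
      exact mul_mem (aeval_mem' _ _ (hDE hVD)) (pow_mem hWE n)
  · intro s hs hsN h0
    rw [Polynomial.map_neg, natDegree_neg] at h0
    have h1 := hredp' s hs hsN
    rw [hredp s hs hsN, eq_C_of_natDegree_eq_zero h0, aeval_C, CC_eq, C_inj] at h1
    exact hnd s hs hsN (by rw [h1]; simp)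

end TriAux

namespace TriAux
open Polynomial

/-- Conjugate of a derivation by an algebra isomorphism. -/
def conj {k S R : Type*} [CommRing k] [CommRing S] [CommRing R] [Algebra k S] [Algebra k R]
    (e : S ≃ₐ[k] R) (D : Derivation k R R) : Derivation k S S :=
  Derivation.mk' (e.symm.toLinearMap ∘ₗ D.toLinearMap ∘ₗ e.toLinearMap) (by
    intro a b
    simp)

theorem conj_apply {k S R : Type*} [CommRing k] [CommRing S] [CommRing R] [Algebra k S]
    [Algebra k R] (e : S ≃ₐ[k] R) (D : Derivation k R R) (x : S) :
    conj e D x = e.symm (D (e x)) := rfl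

/-- Extend the base ring of a derivation to a ring of constants. -/
def liftDer {k B R : Type*} [CommRing k] [CommRing B] [CommRing R] [Algebra k R] [Algebra B R]
    (D : Derivation k R R) (h : ∀ a : B, D (algebraMap B R a) = 0) : Derivation B R R :=
  Derivation.mk' { toFun := D, map_add' := map_add D, map_smul' := by
                    intro a x
                    simp [Algebra.smul_def, h] } (by
    intro a b
    simp)

theorem liftDer_apply {k B R : Type*} [CommRing k] [CommRing B] [CommRing R] [Algebra k R]
    [Algebra B R] (D : Derivation k R R) (h : ∀ a : B, D (algebraMap B R a) = 0) (x : R) :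
    liftDer D h x = D x := rfl

variable {A : Type*} [CommRing A]

/-- Substitution homomorphism. -/
def sub2 (v w : A[X][X]) : A[X][X] →ₐ[A] A[X][X] :=
  { eval₂RingHom (aeval v : A[X] →ₐ[A] A[X][X]).toRingHom w with
    commutes' := by intro a; simp }

theorem sub2_C (v w : A[X][X]) (q : A[X]) : sub2 v w (C q) = aeval v q := by
  simp [sub2]

theorem sub2_X (v w : A[X][X]) : sub2 v w X = w := by
  simp [sub2]

theorem top_of_mem {M : Subalgebra A A[X][X]} (h1 : C X ∈ M) (h2 : X ∈ M) : M = ⊤ := by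
  rw [eq_top_iff]
  intro x _
  induction x using Polynomial.induction_on' with
  | add x z hx hz => exact add_mem (hx trivial) (hz trivial)
  | monomial n c =>
    rw [← C_mul_X_pow_eq_monomial, ← aeval_CX]
    exact mul_mem (aeval_mem' _ _ h1) (pow_mem h2 n)

theorem descend [IsDomain A] [IsPrincipalIdealRing A] [CharZero A] {c : A} (hc : c ≠ 0) (e : A) :
    ∀ (D : Derivation A A[X][X] A[X][X]) (G : A[X]) (s : A[X][X]), D (C X) = C (C (e * c)) →
      D X = C (derivative G) → e ≠ 0 → NonConst (e * c) G → D s = C (C c) →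
      ∃ (v w : A[X][X]) (g : A[X]), Algebra.adjoin A {v, w} = ⊤ ∧ D v = C (C c) ∧
        D w = aeval v g := by
  induction e using UniqueFactorizationMonoid.induction_on_prime with
  | h₁ => intro D G s _ _ h; exact absurd rfl h
  | h₂ e he =>
    intro D G s hV hW _ _ _
    obtain ⟨e', rfl⟩ := he
    have hinv : (C (C ((e'⁻¹ : Aˣ) : A)) : A[X][X]) * C (C (e' : A)) = 1 := by
      simp [← C_mul]
    have hCX : (C X : A[X][X]) = C (C (e' : A)) * (C (C ((e'⁻¹ : Aˣ) : A)) * C X) := by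
      linear_combination -(C X) * hinv
    refine ⟨C (C ((e'⁻¹ : Aˣ) : A)) * C X, X, (derivative G).comp (C (e' : A) * X), ?_, ?_, ?_⟩
    · apply top_of_mem
      · have hm : C (C (e' : A)) * (C (C ((e'⁻¹ : Aˣ) : A)) * C X) ∈
            Algebra.adjoin A {(C (C ((e'⁻¹ : Aˣ) : A)) * C X : A[X][X]), X} :=
          mul_mem (Subalgebra.algebraMap_mem _ (e' : A)) (Algebra.subset_adjoin (Or.inl rfl))
        exact Set.mem_of_eq_of_mem hCX hm
      · exact Algebra.subset_adjoin (by simp)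
    · rw [D.leibniz, D_CC, hV]
      simp only [smul_eq_mul, C_mul, mul_zero, add_zero]
      linear_combination (C (C c)) * hinv
    · rw [hW, aeval_comp, map_mul, aeval_C, aeval_X, CC_eq, ← hCX, aeval_CX]
  | h₃ e r he hr ih =>
    intro D G s hV hW _ hG hs
    rw [mul_assoc] at hV hG
    have hsl : D (C (C e) * s) = C (C (e * c)) := by
      rw [D.leibniz, D_CC, hs]; simp
    obtain ⟨v, w, G2, htop, hv, hw, hG2⟩ := step D hV hW (mul_ne_zero he hc) hr hG hsl
    have hsur : Function.Surjective (sub2 v w) := by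
      rw [← AlgHom.range_eq_top, eq_top_iff, ← htop, Algebra.adjoin_le_iff]
      rintro x (rfl | rfl)
      · exact ⟨C X, (sub2_C _ _ _).trans (aeval_X _)⟩
      · exact ⟨X, sub2_X _ _⟩
    have hinj : Function.Injective (sub2 v w) := endo_inj (sub2 v w).toRingHom hsur
    let σ : A[X][X] ≃ₐ[A] A[X][X] := AlgEquiv.ofBijective (sub2 v w) ⟨hinj, hsur⟩
    have hσC : ∀ q, σ (C q) = aeval v q := fun q => sub2_C v w q
    have hσX : σ X = w := sub2_X v w
    have hσCC : ∀ a, σ (C (C a)) = C (C a) := fun a => by rw [hσC, aeval_C, CC_eq]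
    obtain ⟨v', w', g, htop', hv', hw'⟩ := ih (conj σ D) G2 (σ.symm s)
      (by rw [conj_apply, hσC, aeval_X, hv, AlgEquiv.symm_apply_eq, hσCC])
      (by rw [conj_apply, hσX, hw, AlgEquiv.symm_apply_eq, hσC]) he hG2
      (by rw [conj_apply, AlgEquiv.apply_symm_apply, hs, AlgEquiv.symm_apply_eq, hσCC])
    refine ⟨σ v', σ w', g, ?_, ?_, ?_⟩
    · have : ({σ v', σ w'} : Set A[X][X]) = σ.toAlgHom '' {v', w'} := by
        simp [Set.image_pair]
      rw [this, Algebra.adjoin_image, htop', Algebra.map_top, AlgHom.range_eq_top]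
      exact σ.surjective
    · rw [conj_apply, AlgEquiv.symm_apply_eq, hσCC] at hv'
      exact hv'
    · rw [conj_apply, AlgEquiv.symm_apply_eq] at hw'
      rw [hw']
      exact (aeval_algHom_apply σ.toAlgHom v' g).symm

theorem const_of_dvd {F R : Type*} [Field F] [CommRing R] [IsDomain R] [Algebra F R] {x : R[X]}
    {ρ : F[X]} (hρ : ρ.natDegree ≠ 0) {c : R} (hc : c ≠ 0) (h : aeval x ρ ∣ C c) :
    ∃ y, x = C y ∧ aeval y ρ ∣ c := by
  have h1 : aeval x ρ = (ρ.map (algebraMap F R)).comp x := by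
    rw [comp, eval₂_map, aeval_def]; rfl
  have h2 := natDegree_le_of_dvd h (by simpa using hc)
  rw [h1, natDegree_comp, natDegree_C, natDegree_map] at h2
  have h3 : x.natDegree = 0 := by
    have := Nat.le_zero.mp h2
    rcases Nat.mul_eq_zero.mp this with h | h
    · exact absurd h hρ
    · exact h
  refine ⟨_, eq_C_of_natDegree_eq_zero h3, ?_⟩
  rw [eq_C_of_natDegree_eq_zero h3] at h
  have h4 : aeval (C (x.coeff 0)) ρ = C (aeval (x.coeff 0) ρ) := by
      rw [aeval_def, aeval_def, hom_eval₂]; rfl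
  rw [h4, C_dvd_iff_dvd_coeff] at h
  simpa using h 0

theorem const2_of_dvd {F : Type*} [Field F] {x : F[X][X][X]}
    {ρ : F[X]} (hρ : ρ.natDegree ≠ 0) {c : F[X]} (hc : c ≠ 0) (h : aeval x ρ ∣ C (C c)) :
    ∃ b : F[X], x = C (C b) := by
  obtain ⟨y, rfl, hy⟩ := const_of_dvd hρ (by simpa using hc) h
  obtain ⟨b, rfl, _⟩ := const_of_dvd hρ hc hy
  exact ⟨b, rfl⟩

/-- Substitution of three polynomials. -/
def sub3 {F R : Type*} [Field F] [CommRing R] [Algebra F R] (u v w : R) : F[X][X][X] →ₐ[F] R :=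
  { eval₂RingHom (eval₂RingHom (aeval u : F[X] →ₐ[F] R).toRingHom v) w with
    commutes' := by
      intro a
      change eval₂ (eval₂RingHom (aeval u : F[X] →ₐ[F] R).toRingHom v) w (C (C (C a))) = _
      simp }

theorem sub3_CC {F R : Type*} [Field F] [CommRing R] [Algebra F R] (u v w : R) (a : F[X]) :
    sub3 u v w (C (C a)) = aeval u a := by simp [sub3]

theorem sub3_CX {F R : Type*} [Field F] [CommRing R] [Algebra F R] (u v w : R) :
    sub3 (F := F) u v w (C X) = v := by simp [sub3]

theorem sub3_X {F R : Type*} [Field F] [CommRing R] [Algebra F R] (u v w : R) :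
    sub3 (F := F) u v w X = w := by simp [sub3]

theorem exists_equiv {F : Type*} [Field F] {u v w : MvPolynomial (Fin 3) F}
    (h : Algebra.adjoin F {u, v, w} = ⊤) :
    ∃ Φ : F[X][X][X] ≃ₐ[F] MvPolynomial (Fin 3) F,
      (∀ a, Φ (C (C a)) = aeval u a) ∧ Φ (C X) = v ∧ Φ X = w := by
  have hsur : Function.Surjective (sub3 (F := F) u v w) := by
    rw [← AlgHom.range_eq_top, eq_top_iff, ← h, Algebra.adjoin_le_iff]
    rintro x (rfl | rfl | rfl)
    · exact ⟨C (C X), (sub3_CC _ _ _ _).trans (aeval_X _)⟩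
    · exact ⟨C X, sub3_CX _ _ _⟩
    · exact ⟨X, sub3_X _ _ _⟩
  let ψ : MvPolynomial (Fin 3) F →ₐ[F] F[X][X][X] := 
    MvPolynomial.aeval (![C (C X), C X, X] : Fin 3 → F[X][X][X])
  have hψ : Function.Surjective ψ := by
    have hT : (C (C X) : F[X][X][X]) ∈ ψ.range := ⟨MvPolynomial.X 0, by simp [ψ]⟩
    have hV : (C X : F[X][X][X]) ∈ ψ.range := ⟨MvPolynomial.X 1, by simp [ψ]⟩
    have hW : (X : F[X][X][X]) ∈ ψ.range := ⟨MvPolynomial.X 2, by simp [ψ]⟩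
    have h1 : ∀ a : F[X], (C (C a) : F[X][X][X]) ∈ ψ.range := by
      intro a
      induction a using Polynomial.induction_on' with
      | add p q hp hq => rw [C_add, C_add]; exact add_mem hp hq
      | monomial n a =>
        rw [← C_mul_X_pow_eq_monomial, C_mul, C_mul, C_pow, C_pow]
        exact mul_mem (ψ.range.algebraMap_mem a) (pow_mem hT n)
    have h2 : ∀ a : F[X][X], (C a : F[X][X][X]) ∈ ψ.range := by
      intro a
      induction a using Polynomial.induction_on' with
      | add p q hp hq => rw [C_add]; exact add_mem hp hq
      | monomial n a =>
        rw [← C_mul_X_pow_eq_monomial, C_mul, C_pow]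
        exact mul_mem (h1 a) (pow_mem hV n)
    intro x
    change x ∈ ψ.range
    induction x using Polynomial.induction_on' with
    | add p q hp hq => exact add_mem hp hq
    | monomial n a =>
      rw [← C_mul_X_pow_eq_monomial]
      exact mul_mem (h2 a) (pow_mem hW n)
  have hinj : Function.Injective (sub3 (F := F) u v w) := by
    have := endo_inj (R := F[X][X][X]) (ψ.comp (sub3 (F := F) u v w)).toRingHom (by
      exact hψ.comp hsur)
    exact Function.Injective.of_comp (f := ψ) this
  exact ⟨AlgEquiv.ofBijective _ ⟨hinj, hsur⟩, sub3_CC u v w, sub3_CX u v w, sub3_X u v w⟩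

theorem mem_of_adjoin {F R : Type*} [Field F] [CommRing R] [Algebra F R]
    (Φ : F[X][X][X] ≃ₐ[F] R) {u : R} (hΦ : ∀ a, Φ (C (C a)) = aeval u a) (M : Subalgebra F R)
    (hu : u ∈ M) {s : Set F[X][X][X]} (hs : ∀ y ∈ s, Φ y ∈ M) {x : F[X][X][X]}
    (hx : x ∈ Algebra.adjoin F[X] s) : Φ x ∈ M := by
  induction hx using Algebra.adjoin_induction with
  | mem x hx => exact hs x hx
  | algebraMap a =>
    rw [CC_eq, hΦ]
    have := (aeval (⟨u, hu⟩ : M) a).2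
    rwa [← Subalgebra.aeval_coe] at this
  | add x y _ _ hx hy => rw [map_add]; exact add_mem hx hy
  | mul x y _ _ hx hy => rw [map_mul]; exact mul_mem hx hy

/-- Slice theorem, generation part. -/
theorem slice_gen {F R : Type*} [Field F] [CharZero F] [CommRing R] [Algebra F R]
    (D : Derivation F R R) (B : Subalgebra F R) (hB : ∀ x, D x = 0 ↔ x ∈ B) {t : R}
    (ht : D t = 1) (n : ℕ) : ∀ x, (⇑D)^[n] x = 0 → ∃ Q : B[X], aeval t Q = x := by
  induction n with
  | zero => intro x hx; exact ⟨0, by simpa using hx.symm⟩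
  | succ n ih =>
    intro x hx
    obtain ⟨Q, hQ⟩ := ih (D x) (by rw [Function.iterate_succ_apply] at hx; exact hx)
    obtain ⟨Q1, rfl⟩ := antideriv (F := F) Q
    let D' : Derivation B R R := liftDer D (fun b => (hB _).mpr b.2)
    have h1 : D (aeval t Q1) = D x := by
      rw [← hQ]
      have := Derivation.map_aeval D' Q1 t
      rw [show D' t = 1 from ht, smul_eq_mul, mul_one] at this
      exact this
    have h2 : x - aeval t Q1 ∈ B := by rw [← hB, map_sub, h1, sub_self]
    exact ⟨Q1 + C ⟨_, h2⟩, by rw [map_add, aeval_C]; simp [Subalgebra.algebraMap_def]⟩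

end TriAux

namespace TriAux
open Polynomial

theorem corank_ge {k : Type} [Field k] (X : Derivation k (PolyR k) (PolyR k)) {f g h : PolyR k}
    (hT : Algebra.adjoin k {f, g, h} = ⊤) (hf : X f = 0) (hg : X g = 0) : rankD k X ≠ 2 := by
  have h2 : 2 ≤ corank k X := by
    unfold corank
    apply le_csSup
    · refine ⟨3, ?_⟩
      rintro r ⟨l, rfl, _, m, hm, _⟩
      rw [List.length_append] at hm
      omega
    · refine ⟨[f, g], rfl, by simp [hf, hg], [h], rfl, ?_⟩
      rw [← hT]
      congr 1
      ext x
      simp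
  unfold rankD
  omega

theorem no_slice {k : Type} [Field k] [CharZero k] (X : Derivation k (PolyR k) (PolyR k))
    (hln : LND k X) (hrk : rankD k X = 2) (u p : PolyR k)
    (hker : {a : PolyR k | X a = 0} = (Algebra.adjoin k {u, p} : Subalgebra k (PolyR k)))
    (t : PolyR k) (ht : X t = 1) : False := by
  have hB : ∀ x, X x = 0 ↔ x ∈ Algebra.adjoin k {u, p} := fun x => by
    have := Set.ext_iff.mp hker x
    simpa using this
  have hu : X u = 0 := (hB u).mpr (Algebra.subset_adjoin (by simp))
  have hp : X p = 0 := (hB p).mpr (Algebra.subset_adjoin (by simp))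
  refine corank_ge X (f := u) (g := p) (h := t) ?_ hu hp hrk
  rw [eq_top_iff]
  intro x _
  obtain ⟨n, _, hn⟩ := hln x
  obtain ⟨Q, rfl⟩ := slice_gen X _ hB ht n x hn
  rw [aeval_eq_sum_range]
  refine sum_mem fun i _ => ?_
  rw [Algebra.smul_def]
  refine mul_mem ?_ (pow_mem (Algebra.subset_adjoin (by simp)) i)
  exact Algebra.adjoin_mono (by intro y; simp; tauto) (Q.coeff i).2

theorem dvd_der {k R : Type*} [CommRing k] [CommRing R] [Algebra k R]
    (D : Derivation k R R) (d : R) (s : Set R) (hs : ∀ y ∈ s, d ∣ D y)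
    (hT : Algebra.adjoin k s = ⊤) (x : R) : d ∣ D x := by
  have hx : x ∈ Algebra.adjoin k s := by rw [hT]; trivial
  induction hx using Algebra.adjoin_induction with
  | mem x hx => exact hs x hx
  | algebraMap a => simp
  | add x y _ _ hx hy => rw [map_add]; exact dvd_add hx hy
  | mul x y _ _ hx hy =>
    rw [D.leibniz]
    exact dvd_add (hy.mul_left _) (hx.mul_left _)

theorem adjoin_pair {k R : Type*} [CommRing k] [CommRing R] [Algebra k R] (a b : R) :
    Algebra.adjoin k {a, b} = (MvPolynomial.aeval ![a, b] : 
      MvPolynomial (Fin 2) k →ₐ[k] R).range := by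
  rw [← Algebra.adjoin_range_eq_range_aeval]
  congr 1
  ext x
  simp [eq_comm, or_comm]

end TriAux

namespace TriAux
open Polynomial

theorem bez {A : Type*} [CommRing A] (D : Derivation A A[X][X] A[X][X]) {s : A[X][X]} {c f x y : A}
    (hs : D s = C (C c)) (hV : D (C X) = C (C f)) :
    D (C (C x) * s + C (C y) * C X) = C (C (c * x + f * y)) := by
  rw [map_add, D.leibniz, D.leibniz, D_CC, D_CC, hs, hV]
  simp only [smul_eq_mul, C_mul, C_add, mul_zero, add_zero]
  ring

theorem exists_der {k B S R : Type*} [CommRing k] [CommRing B] [CommRing S] [CommRing R]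
    [Algebra k S] [Algebra k R] [Algebra B S] (Φ : S ≃ₐ[k] R) (Δ : Derivation k R R)
    (h : ∀ a : B, Δ (Φ (algebraMap B S a)) = 0) :
    ∃ D : Derivation B S S, ∀ x, Φ (D x) = Δ (Φ x) := by
  have hD0 : ∀ a : B, conj Φ Δ (algebraMap B S a) = 0 := fun a => by
    rw [conj_apply, h, map_zero]
  exact ⟨liftDer (conj Φ Δ) hD0, fun x => by
      rw [liftDer_apply, conj_apply, AlgEquiv.apply_symm_apply]⟩

set_option maxHeartbeats 400000 in
theorem main_aux {k : Type} [Field k] [CharZero k]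
    (Δ : Derivation k (PolyR k) (PolyR k))
    (hln : LND k Δ) (hirr : IrredDer k Δ) (hrk : rankD k Δ = 2)
    (htri : Triangulable k Δ)
    (u p : PolyR k) (hu : IsCoord k u)
    (hker : {a : PolyR k | Δ a = 0} = (Algebra.adjoin k {u, p} : Subalgebra k (PolyR k)))
    (s : PolyR k) (hs : IsMinLocalSlice k Δ s)
    (c : k[X]) (hc : Δ s = aeval u c) :
    ∃ (v w : PolyR k) (q : MvPolynomial (Fin 2) k),
      IsCoordSys k u v w ∧ Δ u = 0 ∧ Δ v = aeval u c ∧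
      Δ w = MvPolynomial.aeval ![u, v] q := by
  have hns : ∀ t, Δ t ≠ 1 := fun t ht => no_slice Δ hln hrk u p hker t ht
  have hDu : Δ u = 0 := by
    have := Set.ext_iff.mp hker u
    exact this.mpr (Algebra.subset_adjoin (by simp))
  obtain ⟨u', v', w', hsys, h1, h2, h3⟩ := htri
  have hu' : Δ u' = 0 := by
    obtain ⟨a, ha⟩ := Algebra.mem_bot.mp h1
    by_cases h0 : a = 0
    · rw [← ha, h0, map_zero]
    · refine absurd ?_ (hns (a⁻¹ • u'))
      rw [Derivation.map_smul, ← ha, Algebra.smul_def, ← map_mul, inv_mul_cancel₀ h0, map_one]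
  obtain ⟨Φ, hΦC, hΦV, hΦW⟩ := exists_equiv hsys
  have hDae : ∀ a : k[X], Δ (aeval u' a) = 0 := fun a => by
    rw [Derivation.map_aeval, hu', smul_zero]
  obtain ⟨D, hD⟩ := exists_der (k := k) (B := k[X]) (S := k[X][X][X]) (R := PolyR k) Φ Δ (fun a => by rw [CC_eq, hΦC, hDae])
  have hD' : ∀ x y, Δ (Φ x) = Φ y → D x = y := fun x y h => Φ.injective ((hD x).trans h)
  rw [Algebra.adjoin_singleton_eq_range_aeval] at h2
  obtain ⟨f, hf⟩ := h2
  replace hf : aeval u' f = Δ v' := hf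
  have hV : D (C X) = C (C f) := hD' _ _ (by rw [hΦV, hΦC, hf])
  obtain ⟨g, hg⟩ : ∃ g : k[X][X], Φ (C g) = Δ w' := by
    have : Algebra.adjoin k {u', v'} ≤
        (Φ.toAlgHom.comp ((CAlgHom : k[X][X] →ₐ[k[X][X]] k[X][X][X]).restrictScalars k)).range := by
      rw [Algebra.adjoin_le_iff]
      rintro x (rfl | rfl)
      · exact ⟨C X, (hΦC X).trans (aeval_X _)⟩
      · exact ⟨X, hΦV⟩
    obtain ⟨g, hg⟩ := this h3
    exact ⟨g, hg⟩
  obtain ⟨G, hG⟩ := antideriv (F := k) g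
  have hW : D X = C (derivative G) := hD' _ _ (by rw [hΦW, hG, hg])
  have hf0 : f ≠ 0 := by
    rintro rfl
    rw [map_zero] at hf
    exact corank_ge Δ hsys hu' hf.symm hrk
  have hNC : NonConst f G := by
    intro r hr hrf h0
    have h4 : (g.map (Ideal.Quotient.mk (Ideal.span {r}))) = 0 := by
      rw [← hG, ← derivative_map, eq_C_of_natDegree_eq_zero h0, derivative_C]
    rw [map_eq_zero_iff] at h4
    have h5 : ∀ x, aeval u' r ∣ Δ x := dvd_der Δ _ _ (by
      rintro y (rfl | rfl | rfl)
      · rw [hu']; exact dvd_zero _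
      · rw [← hf]; exact map_dvd _ hrf
      · rw [← hg, ← hΦC]; obtain ⟨z, rfl⟩ := h4; exact ⟨Φ (C z), by rw [C_mul, map_mul]⟩) hsys
    have h6 := hirr _ (fun i => h5 _)
    rw [← hΦC] at h6
    have h7 := (MulEquiv.isUnit_map Φ).mp h6
    rw [isUnit_C, isUnit_C] at h7
    exact hr.not_isUnit h7
  have hs1 : Δ s ≠ 0 := hs.1.1
  have hs2 : Δ (Δ s) = 0 := hs.1.2
  have hc0 : c ≠ 0 := by rintro rfl; exact hs1 (by rw [hc, map_zero])
  have hDs : D (Φ.symm s) = Φ.symm (Δ s) := hD' _ _ (by simp)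
  obtain ⟨ρ, hρ, hρd⟩ : ∃ r : k[X], Prime r ∧ C (C r) ∣ Φ.symm (Δ s) := by
    rcases improve_all D hV hW hf0 hNC hDs (hD' _ _ (by simp [hs2])) f dvd_rfl ⟨_, hV⟩ with h | h
    · obtain ⟨t, ht⟩ := h
      exact absurd (by rw [← hD, ht, map_one]) (hns (Φ t))
    · exact h
  have hρdeg : ρ.natDegree ≠ 0 := by
    have := hρ.irreducible.natDegree_pos
    omega
  obtain ⟨y, z, huyz⟩ := hu
  obtain ⟨Ψ, hΨC, -, -⟩ := exists_equiv huyz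
  -- the two base coordinates are polynomials in each other
  obtain ⟨a, ha⟩ : ∃ a : k[X], u' = aeval u a := by
    have hd : aeval u' ρ ∣ aeval u c := by
      have : Φ (C (C ρ)) ∣ Φ (Φ.symm (Δ s)) := by
        obtain ⟨z, hz⟩ := hρd
        exact ⟨Φ z, by rw [hz, map_mul]⟩
      rwa [hΦC, AlgEquiv.apply_symm_apply, hc] at this
    have hd2 : aeval (Ψ.symm u') ρ ∣ C (C c) := by
      have : Ψ.symm (aeval u' ρ) ∣ Ψ.symm (aeval u c) := by
        obtain ⟨z, hz⟩ := hd
        exact ⟨Ψ.symm z, by rw [hz, map_mul]⟩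
      rwa [← hΨC, AlgEquiv.symm_apply_apply, ← aeval_algHom_apply] at this
    obtain ⟨a, ha⟩ := const2_of_dvd hρdeg hc0 hd2
    exact ⟨a, by rw [← hΨC, ← ha, AlgEquiv.apply_symm_apply]⟩
  have hsu' : Φ.symm u' = C (C X) := by rw [AlgEquiv.symm_apply_eq, hΦC, aeval_X]
  have hadeg : a.natDegree ≠ 0 := by
    intro h0
    rw [eq_C_of_natDegree_eq_zero h0, aeval_C] at ha
    rw [ha, AlgEquiv.commutes] at hsu'
    have : (C (a.coeff 0) : k[X]) = X := C_injective (C_injective hsu')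
    exact X_ne_C _ this.symm
  obtain ⟨b, hb⟩ : ∃ b : k[X], Φ.symm u = C (C b) := by
    refine const2_of_dvd hadeg (c := X) X_ne_zero ?_
    have : aeval (Φ.symm u) a = Φ.symm (aeval u a) := aeval_algHom_apply Φ.symm u a
    rw [this, ← ha, hsu']
  have hub : u = aeval u' b := by rw [← hΦC, ← hb, AlgEquiv.apply_symm_apply]
  -- the slice derivative in terms of the new base coordinate
  obtain ⟨c', hc'⟩ : ∃ c' : k[X], Δ s = aeval u' c' := ⟨c.comp b, by rw [aeval_comp, ← hub, hc]⟩
  have hc'0 : c' ≠ 0 := by rintro rfl; exact hs1 (by rw [hc', map_zero])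
  have hsl : D (Φ.symm s) = C (C c') := by rw [hDs, hc', ← hΦC, AlgEquiv.symm_apply_apply]
  have hcf : c' ∣ f := by
    classical
    obtain ⟨x, y, hxy⟩ : ∃ x y : k[X], EuclideanDomain.gcd c' f = c' * x + f * y :=
      ⟨_, _, EuclideanDomain.gcd_eq_gcd_ab c' f⟩
    set d := EuclideanDomain.gcd c' f with hd
    have hdc : d ∣ c' := EuclideanDomain.gcd_dvd_left _ _
    have hdf : d ∣ f := EuclideanDomain.gcd_dvd_right _ _
    have hd0 : d ≠ 0 := fun h => hf0 (zero_dvd_iff.mp (h ▸ hdf))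
    have htt : Δ (Φ (C (C x) * Φ.symm s + C (C y) * C X)) = aeval u' d := by
      rw [← hD, bez D hsl hV, hΦC, hxy]
    have hne : aeval u' d ≠ 0 := by
      rw [← hΦC]
      simpa using hd0
    obtain ⟨μ, hμ⟩ := hs.2 _ ⟨by rw [htt]; exact hne, by rw [htt, hDae]⟩
      (by rw [htt, hc']; exact map_dvd _ hdc)
    have h8 : aeval u' c' ∣ aeval u' d := ⟨μ, by rw [← htt, hμ, hc', mul_comm]⟩
    rw [← hΦC, ← hΦC] at h8
    have h9 : Φ.symm (Φ (C (C c'))) ∣ Φ.symm (Φ (C (C d))) := by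
      obtain ⟨z, hz⟩ := h8
      exact ⟨Φ.symm z, by rw [hz, map_mul]⟩
    rw [AlgEquiv.symm_apply_apply, AlgEquiv.symm_apply_apply] at h9
    have h10 : c' ∣ d := by
      have := (C_dvd_iff_dvd_coeff _ _).mp h9 0
      rw [coeff_C_zero] at this
      have := (C_dvd_iff_dvd_coeff _ _).mp this 0
      rwa [coeff_C_zero] at this
    exact h10.trans hdf
  obtain ⟨e, he⟩ := hcf
  rw [mul_comm] at he
  obtain ⟨v2, w2, g2, htop, hv2, hw2⟩ := descend hc'0 e D G (Φ.symm s) (by rw [← he, hV]) hW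
    (by rintro rfl; exact hf0 (by rw [he, zero_mul])) (by rw [← he]; exact hNC) hsl
  have hmem : ∀ M : Subalgebra k (PolyR k), u ∈ M → u' ∈ M := fun M hM => by
    rw [ha]
    have := (aeval (⟨u, hM⟩ : M) a).2
    rwa [← Subalgebra.aeval_coe] at this
  have hq : Δ (Φ w2) ∈ Algebra.adjoin k {u, Φ v2} := by
    rw [← hD, hw2]
    refine mem_of_adjoin Φ hΦC _ (hmem _ (Algebra.subset_adjoin (by simp))) (s := {v2}) ?_
      (aeval_mem_adjoin_singleton _ _)
    rintro y rfl
    exact Algebra.subset_adjoin (by simp)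
  rw [adjoin_pair] at hq
  obtain ⟨q, hq⟩ := hq
  refine ⟨Φ v2, Φ w2, q, ?_, hDu, ?_, hq.symm⟩
  · unfold IsCoordSys
    rw [eq_top_iff]
    intro x _
    rw [← Φ.apply_symm_apply x]
    refine mem_of_adjoin Φ hΦC _ (hmem _ (Algebra.subset_adjoin (by simp))) (s := {v2, w2}) ?_
      (by rw [htop]; trivial)
    rintro y (rfl | rfl)
    · exact Algebra.subset_adjoin (by simp)
    · exact Algebra.subset_adjoin (by simp)
  · rw [← hD, hv2, hΦC, ← hc', hc]

end TriAux

/-- A rank-two irreducible triangulable locally nilpotent derivation admits a triangular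
coordinate system `u,v,w` with `X v = c(u)`, where `c(u) = X s` for a minimal local
slice `s`. -/
theorem triangular_with_minimal_slice {K : Type} [Field K] [CharZero K]
    (X : Derivation K (PolyR K) (PolyR K))
    (hln : LND K X) (hirr : IrredDer K X) (hrk : rankD K X = 2)
    (htri : Triangulable K X)
    (u p : PolyR K) (hu : IsCoord K u)
    (hker : {a : PolyR K | X a = 0} = (Algebra.adjoin K {u, p} : Subalgebra K (PolyR K)))
    (s : PolyR K) (hs : IsMinLocalSlice K X s)
    (c : Polynomial K) (hc : X s = Polynomial.aeval u c) :
    ∃ (v w : PolyR K) (q : MvPolynomial (Fin 2) K),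
      IsCoordSys K u v w ∧ X u = 0 ∧ X v = Polynomial.aeval u c ∧
      X w = MvPolynomial.aeval ![u, v] q := by
  exact TriAux.main_aux X hln hirr hrk htri u p hu hker s hs c hc

end
end

section
/- Let K be a field of characteristic zero and X a rank-two irreducible locally nilpotent K-derivation of K[x,y,z]. Write K[x,y,z]^X = K[u,p] where u is a coordinate of K[x,y,z], let s be a minimal local slice of X, and write X(s) = c(u). Then X is triangulable if and only if the ideal I_c^X = c·K[x,y,z] ∩ K[u,p,s] contains a polynomial of the form H = p + Q(u, s + ℓ(u,p)), where Q and ℓ are polynomials in one variable with coefficients in K[u]. -/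
noncomputable section

variable (K : Type) [Field K] [CharZero K]

/-! ### Helper lemmas -/

/-- Evaluation of `Q ∈ K[u][T]` at `T = t` as a ring homomorphism. -/
def ev2h {K : Type} [Field K] (u t : PolyR K) : Polynomial (Polynomial K) →+* PolyR K :=
  Polynomial.eval₂RingHom (Polynomial.aeval u).toRingHom t

/-- Evaluation of `Q ∈ K[u][V][W]` at `V = v`, `W = w` as a ring homomorphism. -/
def ev3 {K : Type} [Field K] (u v w : PolyR K) :
    Polynomial (Polynomial (Polynomial K)) →+* PolyR K :=
  Polynomial.eval₂RingHom (ev2h u v) w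

theorem ev2_eq {K : Type} [Field K] (u t : PolyR K) (Q : Polynomial (Polynomial K)) :
    ev2 K u t Q = ev2h u t Q := rfl

theorem ev2h_C {K : Type} [Field K] (u t : PolyR K) (h : Polynomial K) :
    ev2h u t (Polynomial.C h) = Polynomial.aeval u h := by
  simp [ev2h]

theorem ev2h_X {K : Type} [Field K] (u t : PolyR K) :
    ev2h u t Polynomial.X = t := by
  simp [ev2h]

theorem ev3_C {K : Type} [Field K] (u v w : PolyR K) (h : Polynomial (Polynomial K)) :
    ev3 u v w (Polynomial.C h) = ev2h u v h := by
  simp [ev3]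

theorem ev3_X {K : Type} [Field K] (u v w : PolyR K) :
    ev3 u v w Polynomial.X = w := by
  simp [ev3]

theorem poly_map_sub {R S : Type} [CommRing R] [CommRing S] (f : Polynomial R →+* S)
    (F G : Polynomial R) : f (F - G) = f F - f G := map_sub _ _ _

theorem poly_dvd_of_sub {R : Type} [CommRing R] {d F G : Polynomial R} (h : d ∣ F - G)
    (h' : d ∣ G) : d ∣ F := by
  have := dvd_add h h'
  rwa [sub_add_cancel] at this

theorem ev3_sub {K : Type} [Field K] (u v w : PolyR K)
    (F G : Polynomial (Polynomial (Polynomial K))) :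
    ev3 u v w (F - G) = ev3 u v w F - ev3 u v w G := poly_map_sub _ _ _

theorem aeval_mem_of_mem {K : Type} [Field K] (S : Subalgebra K (PolyR K)) {u : PolyR K}
    (hu : u ∈ S) (h : Polynomial K) : Polynomial.aeval u h ∈ S := by
  have : Polynomial.aeval u h ∈ Algebra.adjoin K {u} := by
    rw [Algebra.adjoin_singleton_eq_range_aeval]; exact ⟨h, rfl⟩
  exact Algebra.adjoin_le (by simpa using hu) this

theorem ev2h_mem {K : Type} [Field K] (S : Subalgebra K (PolyR K)) {u t : PolyR K}
    (hu : u ∈ S) (ht : t ∈ S) (F : Polynomial (Polynomial K)) : ev2h u t F ∈ S := by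
  induction F using Polynomial.induction_on' with
  | add p q hp hq => rw [map_add]; exact S.add_mem hp hq
  | monomial n a =>
    rw [← Polynomial.C_mul_X_pow_eq_monomial, map_mul, map_pow, ev2h_C, ev2h_X]
    exact S.mul_mem (aeval_mem_of_mem S hu a) (S.pow_mem ht n)

theorem ev3_mem {K : Type} [Field K] (S : Subalgebra K (PolyR K)) {u v w : PolyR K}
    (hu : u ∈ S) (hv : v ∈ S) (hw : w ∈ S) (F : Polynomial (Polynomial (Polynomial K))) :
    ev3 u v w F ∈ S := by
  induction F using Polynomial.induction_on' with
  | add p q hp hq => rw [map_add]; exact S.add_mem hp hq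
  | monomial n a =>
    rw [← Polynomial.C_mul_X_pow_eq_monomial, map_mul, map_pow, ev3_C, ev3_X]
    exact S.mul_mem (ev2h_mem S hu hv a) (S.pow_mem hw n)

theorem exists_aeval {K : Type} [Field K] {u f : PolyR K} (hf : f ∈ Algebra.adjoin K {u}) :
    ∃ h : Polynomial K, Polynomial.aeval u h = f := by
  rw [Algebra.adjoin_singleton_eq_range_aeval] at hf
  exact hf

theorem exists_ev2h {K : Type} [Field K] {u t f : PolyR K}
    (hf : f ∈ Algebra.adjoin K {u, t}) : ∃ F, ev2h u t F = f := by
  induction hf using Algebra.adjoin_induction with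
  | mem x hx =>
    rcases hx with rfl | rfl
    · exact ⟨Polynomial.C Polynomial.X, by rw [ev2h_C, Polynomial.aeval_X]⟩
    · exact ⟨Polynomial.X, ev2h_X _ _⟩
  | algebraMap r =>
    exact ⟨Polynomial.C (Polynomial.C r), by rw [ev2h_C, Polynomial.aeval_C]⟩
  | add x y _ _ hx hy =>
    obtain ⟨F, rfl⟩ := hx; obtain ⟨G, rfl⟩ := hy
    exact ⟨F + G, map_add _ _ _⟩
  | mul x y _ _ hx hy =>
    obtain ⟨F, rfl⟩ := hx; obtain ⟨G, rfl⟩ := hy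
    exact ⟨F * G, map_mul _ _ _⟩

theorem exists_ev3 {K : Type} [Field K] {u v w f : PolyR K}
    (hf : f ∈ Algebra.adjoin K {u, v, w}) : ∃ F, ev3 u v w F = f := by
  induction hf using Algebra.adjoin_induction with
  | mem x hx =>
    rcases hx with rfl | rfl | rfl
    · exact ⟨Polynomial.C (Polynomial.C Polynomial.X), by rw [ev3_C, ev2h_C, Polynomial.aeval_X]⟩
    · exact ⟨Polynomial.C Polynomial.X, by rw [ev3_C, ev2h_X]⟩
    · exact ⟨Polynomial.X, ev3_X _ _ _⟩
  | algebraMap r =>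
    exact ⟨Polynomial.C (Polynomial.C (Polynomial.C r)), by
      rw [ev3_C, ev2h_C, Polynomial.aeval_C]⟩
  | add x y _ _ hx hy =>
    obtain ⟨F, rfl⟩ := hx; obtain ⟨G, rfl⟩ := hy
    exact ⟨F + G, map_add _ _ _⟩
  | mul x y _ _ hx hy =>
    obtain ⟨F, rfl⟩ := hx; obtain ⟨G, rfl⟩ := hy
    exact ⟨F * G, map_mul _ _ _⟩

theorem inj_of_surj_endo {R : Type} [CommRing R] [IsNoetherianRing R] (f : R →+* R)
    (hf : Function.Surjective f) : Function.Injective f := by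
  have hpow : ∀ (n : ℕ) (x : R), (f ^ (n + 1)) x = f ((f ^ n) x) := fun n x => by
    rw [pow_succ']; rfl
  have hpow' : ∀ (n : ℕ) (x : R), (f ^ (n + 1)) x = (f ^ n) (f x) := fun n x => by
    rw [pow_succ]; rfl
  let g : ℕ →o Ideal R := ⟨fun n => RingHom.ker (f ^ n), monotone_nat_of_le_succ fun n x hx => by
    rw [RingHom.mem_ker] at hx ⊢
    rw [hpow, hx, map_zero]⟩
  obtain ⟨n, hn⟩ := monotone_stabilizes_iff_noetherian.2 ‹IsNoetherianRing R› g
  have hsn : ∀ m : ℕ, Function.Surjective (f ^ m) := by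
    intro m
    induction m with
    | zero => exact fun x => ⟨x, rfl⟩
    | succ k ih =>
      intro x
      obtain ⟨y, rfl⟩ := hf x
      obtain ⟨z, rfl⟩ := ih y
      exact ⟨z, hpow k z⟩
  rw [injective_iff_map_eq_zero]
  intro a ha
  obtain ⟨b, rfl⟩ := hsn n a
  have h1 : b ∈ g (n + 1) := by
    show b ∈ RingHom.ker (f ^ (n + 1))
    rw [RingHom.mem_ker, hpow, ha]
  rw [← hn (n + 1) (Nat.le_succ n)] at h1
  exact h1

theorem aeval_injective_of_coord {K : Type} [Field K] {u v w : PolyR K}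
    (h : Algebra.adjoin K {u, v, w} = ⊤) :
    Function.Injective (MvPolynomial.aeval (R := K) ![u, v, w]) := by
  have hs : Function.Surjective (MvPolynomial.aeval (R := K) ![u, v, w]) := by
    rw [← AlgHom.range_eq_top, ← Algebra.adjoin_range_eq_range_aeval, ← h]
    congr 1
    ext x
    simp only [Set.mem_range, Fin.exists_fin_succ, Set.mem_insert_iff, Set.mem_singleton_iff]
    simp [eq_comm]
  exact inj_of_surj_endo
    (MvPolynomial.aeval (R := K) ![u, v, w]).toRingHom hs

theorem ev3_bij {K : Type} [Field K] {u v w : PolyR K}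
    (h : Algebra.adjoin K {u, v, w} = ⊤) : Function.Bijective (ev3 u v w) := by
  refine ⟨?_, fun f => exists_ev3 (h ▸ Algebra.mem_top)⟩
  let θ : PolyR K →ₐ[K] Polynomial (Polynomial (Polynomial K)) :=
    MvPolynomial.aeval (R := K) (S₁ := Polynomial (Polynomial (Polynomial K)))
      ![Polynomial.C (Polynomial.C Polynomial.X), Polynomial.C Polynomial.X, Polynomial.X]
  have e0 : θ (MvPolynomial.X 0) = Polynomial.C (Polynomial.C Polynomial.X) := by simp [θ]
  have e1 : θ (MvPolynomial.X 1) = Polynomial.C Polynomial.X := by simp [θ]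
  have e2 : θ (MvPolynomial.X 2) = Polynomial.X := by simp [θ]
  have hX : ∀ i, ev3 u v w (θ (MvPolynomial.X i)) =
      MvPolynomial.aeval (R := K) ![u, v, w] (MvPolynomial.X i) := by
    intro i
    fin_cases i
    · show ev3 u v w (θ (MvPolynomial.X 0)) = MvPolynomial.aeval ![u, v, w] (MvPolynomial.X 0)
      rw [e0, ev3_C, ev2h_C, Polynomial.aeval_X, MvPolynomial.aeval_X]; rfl
    · show ev3 u v w (θ (MvPolynomial.X 1)) = MvPolynomial.aeval ![u, v, w] (MvPolynomial.X 1)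
      rw [e1, ev3_C, ev2h_X, MvPolynomial.aeval_X]; rfl
    · show ev3 u v w (θ (MvPolynomial.X 2)) = MvPolynomial.aeval ![u, v, w] (MvPolynomial.X 2)
      rw [e2, ev3_X, MvPolynomial.aeval_X]; rfl
  have h1 : ∀ f, ev3 u v w (θ f) = MvPolynomial.aeval (R := K) ![u, v, w] f := by
    intro f
    induction f using MvPolynomial.induction_on with
    | C a =>
      have : θ (MvPolynomial.C a) = Polynomial.C (Polynomial.C (Polynomial.C a)) := by
        simp [θ]
      rw [this, ev3_C, ev2h_C]; simp
    | add p q hp hq => rw [map_add, map_add, map_add, hp, hq]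
    | mul_X p i hp =>
      rw [map_mul, map_mul, map_mul, hp, hX i]
  have hsurj : Function.Surjective θ := by
    have c0 : ∀ a : K, Polynomial.C (Polynomial.C (Polynomial.C a)) ∈ θ.range := fun a =>
      θ.range.algebraMap_mem a
    have c1 : ∀ a : Polynomial K, Polynomial.C (Polynomial.C a) ∈ θ.range := by
      intro a
      induction a using Polynomial.induction_on' with
      | add p q hp hq => simp only [map_add]; exact add_mem hp hq
      | monomial n a =>
        rw [← Polynomial.C_mul_X_pow_eq_monomial]; simp only [map_mul, map_pow]
        exact mul_mem (c0 a) (pow_mem (show _ ∈ θ.range from ⟨_, e0⟩) _)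
    have c2 : ∀ a : Polynomial (Polynomial K), Polynomial.C a ∈ θ.range := by
      intro a
      induction a using Polynomial.induction_on' with
      | add p q hp hq => simp only [map_add]; exact add_mem hp hq
      | monomial n a =>
        rw [← Polynomial.C_mul_X_pow_eq_monomial]; simp only [map_mul, map_pow]
        exact mul_mem (c1 a) (pow_mem (show _ ∈ θ.range from ⟨_, e1⟩) _)
    intro a
    show a ∈ θ.range
    induction a using Polynomial.induction_on' with
    | add p q hp hq => exact add_mem hp hq
    | monomial n a =>
      rw [← Polynomial.C_mul_X_pow_eq_monomial]
      exact mul_mem (c2 a) (pow_mem (show _ ∈ θ.range from ⟨_, e2⟩) _)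
  rw [injective_iff_map_eq_zero]
  intro g hg
  obtain ⟨f, rfl⟩ := hsurj g
  rw [h1] at hg
  rw [(injective_iff_map_eq_zero _).1 (aeval_injective_of_coord h) f hg, map_zero]

theorem ev3_dvd {K : Type} [Field K] {u v w : PolyR K}
    (h : Algebra.adjoin K {u, v, w} = ⊤) (F G : Polynomial (Polynomial (Polynomial K))) :
    ev3 u v w F ∣ ev3 u v w G ↔ F ∣ G := by
  refine ⟨?_, map_dvd _⟩
  rintro ⟨t, ht⟩
  obtain ⟨T, rfl⟩ := (ev3_bij h).2 t
  rw [← map_mul] at ht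
  exact ⟨T, (ev3_bij h).1 ht⟩

theorem aeval_eq_ev3 {K : Type} [Field K] (u v w : PolyR K) (h : Polynomial K) :
    Polynomial.aeval u h = ev3 u v w (Polynomial.C (Polynomial.C h)) := by
  rw [ev3_C, ev2h_C]

theorem C_dvd_C {R : Type} [CommRing R] {a b : R}
    (h : Polynomial.C a ∣ Polynomial.C b) : a ∣ b := by
  rw [Polynomial.C_dvd_iff_dvd_coeff] at h
  simpa using h 0

theorem aeval_dvd {K : Type} [Field K] {u v w : PolyR K}
    (h : Algebra.adjoin K {u, v, w} = ⊤) {a b : Polynomial K}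
    (hab : Polynomial.aeval u a ∣ Polynomial.aeval u b) : a ∣ b := by
  rw [aeval_eq_ev3 u v w, aeval_eq_ev3 u v w, ev3_dvd h] at hab
  exact C_dvd_C (C_dvd_C hab)

theorem aeval_inj {K : Type} [Field K] {u v w : PolyR K}
    (h : Algebra.adjoin K {u, v, w} = ⊤) {a : Polynomial K}
    (ha : Polynomial.aeval u a = 0) : a = 0 := by
  rw [aeval_eq_ev3 u v w] at ha
  have := (injective_iff_map_eq_zero _).1 (ev3_bij h).1 _ ha
  simpa using this

theorem aeval_prime {K : Type} [Field K] {u v w : PolyR K}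
    (h : Algebra.adjoin K {u, v, w} = ⊤) {q : Polynomial K} (hq : Irreducible q) :
    Prime (Polynomial.aeval u q) := by
  have h1 : Prime (Polynomial.C (Polynomial.C q)) :=
    Polynomial.prime_C_iff.2 (Polynomial.prime_C_iff.2 hq.prime)
  rw [aeval_eq_ev3 u v w]
  refine ⟨fun h0 => h1.ne_zero ((injective_iff_map_eq_zero _).1 (ev3_bij h).1 _ h0), ?_, ?_⟩
  · intro hun
    have h2 := hun.dvd (a := ev3 u v w 1)
    rw [ev3_dvd h] at h2
    exact h1.not_isUnit (isUnit_of_dvd_one h2)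
  · intro a b hab
    obtain ⟨A, rfl⟩ := (ev3_bij h).2 a
    obtain ⟨B, rfl⟩ := (ev3_bij h).2 b
    rw [← map_mul, ev3_dvd h] at hab
    rw [ev3_dvd h, ev3_dvd h]
    exact h1.dvd_or_dvd hab

theorem eq_C_of_eval₂ {k R : Type} [CommRing k] [CommRing R] [IsDomain R] (i : k →+* R)
    (hi : Function.Injective i) (F : Polynomial R) (G : Polynomial k) (hG : G ≠ 0)
    (h : Polynomial.eval₂ (Polynomial.C.comp i) F G = 0) : F = Polynomial.C (F.coeff 0) := by
  rw [← Polynomial.eval₂_map] at h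
  change (G.map i).comp F = 0 at h
  rw [Polynomial.comp_eq_zero_iff] at h
  rcases h with h | h
  · exact absurd ((Polynomial.map_eq_zero_iff hi).1 h) hG
  · exact h.2

theorem eq_CC_of_eval₂ {k : Type} [CommRing k] [IsDomain k] (F : Polynomial (Polynomial k))
    (G : Polynomial k) (hG : G ≠ 0)
    (h : Polynomial.eval₂ (Polynomial.C.comp Polynomial.C) F G = 0) :
    ∃ a, F = Polynomial.C (Polynomial.C a) := by
  have h1 := eq_C_of_eval₂ _ Polynomial.C_injective F G hG h
  rw [h1, ← Polynomial.hom_eval₂, Polynomial.C_eq_zero] at h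
  have h2 := eq_C_of_eval₂ (RingHom.id k) Function.injective_id (F.coeff 0) G hG h
  exact ⟨_, by rw [h1, h2]⟩

theorem ev2h_ev3 {K : Type} [Field K] (u v w : PolyR K)
    (F : Polynomial (Polynomial (Polynomial K))) (G : Polynomial (Polynomial K)) :
    ev2h u (ev3 u v w F) G =
      ev3 u v w (Polynomial.eval₂ (Polynomial.C.comp Polynomial.C) F G) := by
  rw [Polynomial.hom_eval₂]
  show Polynomial.eval₂ _ _ _ = _
  congr 1
  refine RingHom.ext fun a => ?_
  exact aeval_eq_ev3 u v w a

/-- `K[u]` is algebraically closed in `K[x,y,z]`. -/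
theorem alg_closed_u {K : Type} [Field K] {u v w : PolyR K}
    (h : Algebra.adjoin K {u, v, w} = ⊤) (f : PolyR K) (G : Polynomial (Polynomial K))
    (hG : G ≠ 0) (hf : ev2h u f G = 0) : ∃ a : Polynomial K, f = Polynomial.aeval u a := by
  obtain ⟨F, rfl⟩ := (ev3_bij h).2 f
  rw [ev2h_ev3] at hf
  obtain ⟨a, rfl⟩ := eq_CC_of_eval₂ F G hG ((injective_iff_map_eq_zero _).1 (ev3_bij h).1 _ hf)
  exact ⟨a, (aeval_eq_ev3 u v w a).symm⟩

/-- Reduction modulo `q` of the coefficients. -/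
def redq {K : Type} [Field K] (q : Polynomial K) :
    Polynomial (Polynomial (Polynomial K)) →+* Polynomial (Polynomial (AdjoinRoot q)) :=
  Polynomial.mapRingHom (Polynomial.mapRingHom (AdjoinRoot.mk q))

theorem redq_sub {K : Type} [Field K] (q : Polynomial K)
    (F G : Polynomial (Polynomial (Polynomial K))) :
    redq q (F - G) = redq q F - redq q G := poly_map_sub _ _ _

theorem map_mk_eq_zero {K : Type} [Field K] (q : Polynomial K) (G : Polynomial (Polynomial K)) :
    G.map (AdjoinRoot.mk q) = 0 ↔ Polynomial.C q ∣ G := by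
  rw [Polynomial.C_dvd_iff_dvd_coeff, Polynomial.ext_iff]
  simp [Polynomial.coeff_map, AdjoinRoot.mk_eq_zero]

theorem redq_eq_zero {K : Type} [Field K] (q : Polynomial K)
    (F : Polynomial (Polynomial (Polynomial K))) :
    redq q F = 0 ↔ Polynomial.C (Polynomial.C q) ∣ F := by
  rw [Polynomial.C_dvd_iff_dvd_coeff, Polynomial.ext_iff]
  simp only [redq, Polynomial.coe_mapRingHom, Polynomial.coeff_map, Polynomial.coeff_zero,
    map_mk_eq_zero]

theorem redq_CC {K : Type} [Field K] (q a : Polynomial K) :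
    redq q (Polynomial.C (Polynomial.C a)) = Polynomial.C (Polynomial.C (AdjoinRoot.mk q a)) := by
  simp [redq]

/-- `K[u]/q` is algebraically closed in `K[x,y,z]/q`. -/
theorem alg_closed_q {K : Type} [Field K] {u v w : PolyR K}
    (h : Algebra.adjoin K {u, v, w} = ⊤) {q : Polynomial K} (hq : Irreducible q) (f : PolyR K)
    (G : Polynomial (Polynomial K)) (hG : ¬ Polynomial.C q ∣ G)
    (hf : Polynomial.aeval u q ∣ ev2h u f G) :
    ∃ a : Polynomial K, Polynomial.aeval u q ∣ f - Polynomial.aeval u a := by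
  have : Fact (Irreducible q) := ⟨hq⟩
  obtain ⟨F, rfl⟩ := (ev3_bij h).2 f
  rw [ev2h_ev3, aeval_eq_ev3 u v w, ev3_dvd h, ← redq_eq_zero, Polynomial.hom_eval₂] at hf
  have e : (redq q).comp (Polynomial.C.comp Polynomial.C) =
      (Polynomial.C.comp Polynomial.C).comp (AdjoinRoot.mk q) :=
    RingHom.ext fun a => redq_CC q a
  rw [e, ← Polynomial.eval₂_map] at hf
  obtain ⟨l, hl⟩ := eq_CC_of_eval₂ (redq q F) _ (fun h0 => hG ((map_mk_eq_zero q G).1 h0)) hf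
  obtain ⟨a, rfl⟩ := AdjoinRoot.mk_surjective l
  refine ⟨a, ?_⟩
  rw [aeval_eq_ev3 u v w, aeval_eq_ev3 u v w, ← map_sub, ev3_dvd h, ← redq_eq_zero, map_sub, hl,
    redq_CC, sub_self]

theorem der_aeval {K : Type} [Field K] (X : Derivation K (PolyR K) (PolyR K)) {u : PolyR K}
    (hu : X u = 0) (h : Polynomial K) : X (Polynomial.aeval u h) = 0 := by
  rw [Derivation.map_aeval, hu, smul_zero]

theorem der_ev2h {K : Type} [Field K] (X : Derivation K (PolyR K) (PolyR K)) {u : PolyR K}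
    (hu : X u = 0) (t : PolyR K) (Q : Polynomial (Polynomial K)) :
    X (ev2h u t Q) = ev2h u t (Polynomial.derivative Q) * X t := by
  induction Q using Polynomial.induction_on' with
  | add p q hp hq => simp only [map_add, hp, hq, add_mul]
  | monomial n a =>
    rw [Polynomial.derivative_monomial, ← Polynomial.C_mul_X_pow_eq_monomial,
      ← Polynomial.C_mul_X_pow_eq_monomial]
    simp only [map_mul, map_pow, ev2h_C, ev2h_X, map_natCast, Derivation.leibniz,
      Derivation.leibniz_pow, der_aeval X hu, smul_eq_mul, nsmul_eq_mul, mul_zero, add_zero]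
    ring

theorem der_ev3 {K : Type} [Field K] (X : Derivation K (PolyR K) (PolyR K)) {u : PolyR K}
    (hu : X u = 0) (v w : PolyR K) (F : Polynomial (Polynomial (Polynomial K))) :
    ∃ Z, X (ev3 u v w F) = ev3 u v w (Polynomial.derivative F) * X w + Z * X v := by
  induction F using Polynomial.induction_on' with
  | add p q hp hq =>
    obtain ⟨Z1, h1⟩ := hp
    obtain ⟨Z2, h2⟩ := hq
    exact ⟨Z1 + Z2, by simp only [map_add, h1, h2]; ring⟩
  | monomial n a =>
    refine ⟨w ^ n * ev2h u v (Polynomial.derivative a), ?_⟩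
    rw [Polynomial.derivative_monomial, ← Polynomial.C_mul_X_pow_eq_monomial,
      ← Polynomial.C_mul_X_pow_eq_monomial]
    simp only [map_mul, map_pow, ev3_C, ev3_X, map_natCast, Derivation.leibniz,
      Derivation.leibniz_pow, der_ev2h X hu, smul_eq_mul, nsmul_eq_mul]
    ring

theorem dvd_of_derivative {K R : Type} [Field K] [CharZero K] [CommRing R] [Algebra K R] (r : R)
    (F : Polynomial R) (h : Polynomial.C r ∣ Polynomial.derivative F) :
    Polynomial.C r ∣ F - Polynomial.C (F.coeff 0) := by
  rw [Polynomial.C_dvd_iff_dvd_coeff] at h ⊢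
  intro n
  cases n with
  | zero => simp
  | succ n =>
    have h1 := h n
    rw [Polynomial.coeff_derivative] at h1
    have hu : IsUnit ((n : R) + 1) := by
      have : ((n : R) + 1) = algebraMap K R ((n : K) + 1) := by simp
      rw [this]
      exact (IsUnit.mk0 _ (by exact_mod_cast Nat.succ_ne_zero n)).map _
    rw [hu.dvd_mul_right] at h1
    simpa [Polynomial.coeff_C] using h1

/-- Clearing denominators with a local slice. -/
theorem local_slice_gen {K : Type} [Field K] [CharZero K]
    (X : Derivation K (PolyR K) (PolyR K)) (hln : LND K X) (B : Subalgebra K (PolyR K))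
    (hB : ∀ a, X a = 0 → a ∈ B) (s c : PolyR K) (hs : X s = c) (hc : X c = 0) (hsB : s ∈ B)
    (f : PolyR K) : ∃ n : ℕ, c ^ n * f ∈ B := by
  have hcn : ∀ m : ℕ, X (c ^ m) = 0 := fun m => by
    rw [Derivation.leibniz_pow, hc]; simp
  have hlin : ∀ (m : ℕ) (a e : PolyR K), X a = 0 → (⇑X)^[m] (a * e) = a * (⇑X)^[m] e := by
    intro m
    induction m with
    | zero => intro a e _; rfl
    | succ k ih =>
      intro a e ha
      rw [Function.iterate_succ_apply, Function.iterate_succ_apply, Derivation.leibniz, ha]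
      simp [ih a _ ha]
  have hsub : ∀ (m : ℕ) (a e : PolyR K), (⇑X)^[m] (a - e) = (⇑X)^[m] a - (⇑X)^[m] e := by
    intro m
    induction m with
    | zero => intro a e; rfl
    | succ k ih =>
      intro a e
      simp only [Function.iterate_succ_apply, map_sub, ih]
  have hspow : ∀ m : ℕ, (⇑X)^[m] (s ^ m) = (m.factorial : PolyR K) * c ^ m := by
    intro m
    induction m with
    | zero => simp
    | succ k ih =>
      have h1 : X (s ^ (k + 1)) = (((k + 1 : ℕ) : PolyR K) * c) * s ^ k := by
        rw [Derivation.leibniz_pow, hs]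
        simp only [smul_eq_mul, nsmul_eq_mul, Nat.add_sub_cancel]
        ring
      rw [Function.iterate_succ_apply, h1, hlin, ih, Nat.factorial_succ]
      · push_cast; ring
      · rw [Derivation.leibniz, hc, Derivation.map_natCast]; simp
  have main : ∀ (m : ℕ) (f : PolyR K), (⇑X)^[m] f = 0 → ∃ n : ℕ, c ^ n * f ∈ B := by
    intro m
    induction m with
    | zero => intro f hf; exact ⟨0, by simp at hf; simp [hf, B.zero_mem]⟩
    | succ m ih =>
      intro f hf
      set e := (⇑X)^[m] f with he
      have hXe : X e = 0 := by rw [he, ← Function.iterate_succ_apply' X m f]; exact hf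
      let k : PolyR K := MvPolynomial.C ((m.factorial : K)⁻¹)
      have hk : k * (m.factorial : PolyR K) = 1 := by
        have h0 : (m.factorial : K) ≠ 0 := by exact_mod_cast Nat.factorial_ne_zero m
        have h1 : (m.factorial : PolyR K) = MvPolynomial.C (m.factorial : K) := by simp
        rw [h1, ← MvPolynomial.C_mul, inv_mul_cancel₀ h0, MvPolynomial.C_1]
      have hXk : X (k * e) = 0 := by
        have : X k = 0 := X.map_algebraMap _
        rw [Derivation.leibniz, hXe, this]; simp
      obtain ⟨n, hn⟩ := ih (c ^ m * f - (k * e) * s ^ m) (by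
        rw [hsub, hlin _ _ _ (hcn m), hlin _ _ _ hXk, hspow, ← he]
        linear_combination (-e * c ^ m) * hk)
      refine ⟨n + m, ?_⟩
      have h2 : c ^ (n + m) * f = c ^ n * (c ^ m * f - (k * e) * s ^ m)
          + c ^ n * ((k * e) * s ^ m) := by ring
      rw [h2]
      exact B.add_mem hn (B.mul_mem (B.pow_mem (hB _ hc) n)
        (B.mul_mem (hB _ hXk) (B.pow_mem hsB m)))
  obtain ⟨n, -, hn⟩ := hln f
  exact main n f hn

/-- A reduction of a minimal local slice modulo a prime factor of `c` is not a constant. -/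
theorem min_slice_contra {K : Type} [Field K] (X : Derivation K (PolyR K) (PolyR K))
    {u v w : PolyR K} (h : Algebra.adjoin K {u, v, w} = ⊤) (hu : X u = 0)
    {s : PolyR K} (hs : IsMinLocalSlice K X s) {q : Polynomial K}
    (hq : Irreducible q) (f : PolyR K)
    (hf : X f = 0) (hd : Polynomial.aeval u q ∣ s - f) : False := by
  obtain ⟨t, ht⟩ := hd
  have hp := aeval_prime h hq
  have h1 : X s = Polynomial.aeval u q * X t := by
    have := congrArg X ht
    rw [map_sub, hf, sub_zero, Derivation.leibniz, der_aeval X hu] at this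
    simpa using this
  have hXt : X t ≠ 0 := fun h0 => hs.1.1 (by rw [h1, h0, mul_zero])
  have hXXt : X (X t) = 0 := by
    have := hs.1.2
    rw [h1, Derivation.leibniz, der_aeval X hu, smul_zero, add_zero, smul_eq_mul] at this
    exact (mul_eq_zero.1 this).resolve_left hp.ne_zero
  obtain ⟨μ, hμ⟩ := hs.2 t ⟨hXt, hXXt⟩ ⟨_, by rw [h1, mul_comm]⟩
  rw [h1] at hμ
  apply hp.not_isUnit
  refine IsUnit.of_mul_eq_one (μ : PolyR K) ?_
  apply mul_right_cancel₀ hXt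
  linear_combination -hμ

theorem ev2h_sub_dvd {K : Type} [Field K] (u t t' : PolyR K) (F : Polynomial (Polynomial K)) :
    t - t' ∣ ev2h u t F - ev2h u t' F := by
  have h1 : ∀ r, ev2h u r F = (F.map (Polynomial.aeval u).toRingHom).eval r := fun r => by
    rw [Polynomial.eval_map]; rfl
  rw [h1, h1]
  exact Polynomial.sub_dvd_eval_sub _ _ _

theorem rank_contra {K : Type} [Field K] (X : Derivation K (PolyR K) (PolyR K))
    (hrk : rankD K X = 2) {a b d : PolyR K} (h : Algebra.adjoin K {a, b, d} = ⊤)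
    (ha : X a = 0) (hb : X b = 0) : False := by
  have h2 : 2 ≤ corank K X := by
    refine le_csSup ⟨3, ?_⟩ ⟨[a, b], rfl, ?_, [d], rfl, ?_⟩
    · rintro r ⟨l, rfl, -, m, hm, -⟩
      rw [List.length_append] at hm
      omega
    · intro f hf
      simp only [List.mem_cons, List.not_mem_nil, or_false] at hf
      rcases hf with rfl | rfl <;> assumption
    · rw [← h]
      congr 1
      ext x
      simp
  unfold rankD at hrk
  omega

/-- A derivation of rank two has no slice. -/
theorem slice_contra {K : Type} [Field K] [CharZero K] (X : Derivation K (PolyR K) (PolyR K))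
    (hln : LND K X) (hrk : rankD K X = 2) {u p : PolyR K} (hu : X u = 0) (hp : X p = 0)
    (hker : ∀ a, X a = 0 → a ∈ Algebra.adjoin K {u, p}) {t : PolyR K} {k : K} (hk : k ≠ 0)
    (ht : X t = algebraMap K (PolyR K) k) : False := by
  refine rank_contra X hrk (a := u) (b := p) (d := t) ?_ hu hp
  rw [eq_top_iff]
  intro f _
  obtain ⟨n, hn⟩ := local_slice_gen X hln (Algebra.adjoin K {u, p, t})
    (fun a ha => Algebra.adjoin_mono (by
      rintro x (rfl | rfl) <;> simp) (hker a ha)) t _ ht (X.map_algebraMap k)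
    (Algebra.subset_adjoin (by simp)) f
  have h1 : f = (k ^ n)⁻¹ • (algebraMap K (PolyR K) k ^ n * f) := by
    rw [← map_pow, ← Algebra.smul_def, smul_smul, inv_mul_cancel₀ (pow_ne_zero n hk), one_smul]
  rw [h1]
  exact Subalgebra.smul_mem _ hn _

theorem p_not_mem {K : Type} [Field K] [CharZero K] (X : Derivation K (PolyR K) (PolyR K))
    (hln : LND K X) {u g h p s : PolyR K} (hco : Algebra.adjoin K {u, g, h} = ⊤) (hu : X u = 0)
    (hker : ∀ a, X a = 0 → a ∈ Algebra.adjoin K {u, p}) {c : Polynomial K} (hc0 : c ≠ 0)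
    (hc : X s = Polynomial.aeval u c) (a : Polynomial K) (hp : p = Polynomial.aeval u a) :
    False := by
  have hgen := local_slice_gen X hln (Algebra.adjoin K {u, s}) (fun b hb => by
    have h1 : Algebra.adjoin K {u, p} ≤ Algebra.adjoin K {u, s} := by
      refine Algebra.adjoin_le ?_
      rintro x (rfl | rfl)
      · exact Algebra.subset_adjoin (by simp)
      · rw [hp]
        exact aeval_mem_of_mem _ (Algebra.subset_adjoin (by simp)) a
    exact h1 (hker b hb)) s _ hc (der_aeval X hu c) (Algebra.subset_adjoin (by simp))
  obtain ⟨S, rfl⟩ := (ev3_bij hco).2 s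
  have hcomp : ∀ F : Polynomial (Polynomial K),
      Polynomial.eval₂ (Polynomial.C.comp Polynomial.C) S F = (F.map Polynomial.C).comp S := by
    intro F
    rw [← Polynomial.eval₂_map]; rfl
  obtain ⟨n, hn⟩ := hgen g
  obtain ⟨m, hm⟩ := hgen h
  obtain ⟨F, hF⟩ := exists_ev2h hn
  obtain ⟨G, hG⟩ := exists_ev2h hm
  rw [ev2h_ev3, hcomp, ← map_pow, aeval_eq_ev3 u g h] at hF hG
  have hF' : (F.map Polynomial.C).comp S = Polynomial.C (Polynomial.C (c ^ n) * Polynomial.X) := by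
    apply (ev3_bij hco).1
    rw [hF, map_mul, map_mul, ev3_C _ _ _ Polynomial.X, ev2h_X]
  have hG' : (G.map Polynomial.C).comp S = Polynomial.C (Polynomial.C (c ^ m)) * Polynomial.X := by
    apply (ev3_bij hco).1
    rw [hG, map_mul, ev3_X]
  have d1 := congrArg Polynomial.natDegree hF'
  have d2 := congrArg Polynomial.natDegree hG'
  have hcm : Polynomial.C (c ^ m) ≠ 0 := by simpa using fun h => absurd h hc0
  rw [Polynomial.natDegree_comp, Polynomial.natDegree_C] at d1
  rw [Polynomial.natDegree_comp, Polynomial.natDegree_C_mul_X _ hcm] at d2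
  have d3 : S.natDegree = 1 := Nat.eq_one_of_mul_eq_one_left d2
  rw [d3, mul_one, Polynomial.natDegree_map_eq_of_injective Polynomial.C_injective] at d1
  rw [Polynomial.eq_C_of_natDegree_eq_zero d1] at hF'
  simp only [Polynomial.map_C, Polynomial.C_comp] at hF'
  have h3 := congrArg (fun r => Polynomial.coeff r 1) (Polynomial.C_injective hF')
  simp only [Polynomial.coeff_C_mul, Polynomial.coeff_X_one, mul_one] at h3
  rw [Polynomial.coeff_C_of_ne_zero one_ne_zero] at h3
  exact pow_ne_zero n hc0 h3.symm

theorem back_direction {K : Type} [Field K] [CharZero K] (X : Derivation K (PolyR K) (PolyR K))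
    (hln : LND K X) {u g h p s v : PolyR K} (hco : Algebra.adjoin K {u, g, h} = ⊤) (hu : X u = 0)
    (hp : X p = 0) (hker : ∀ a, X a = 0 → a ∈ Algebra.adjoin K {u, p})
    (hs : IsMinLocalSlice K X s) {c : Polynomial K} (hc : X s = Polynomial.aeval u c)
    (Q : Polynomial (Polynomial K)) (hv : p + ev2h u s Q = Polynomial.aeval u c * v) :
    Triangulable K X := by
  have hc0 : c ≠ 0 := by
    rintro rfl
    exact hs.1.1 (by rw [hc, map_zero])
  have hcu0 : Polynomial.aeval u c ≠ 0 := fun h0 => hc0 (aeval_inj hco h0)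
  have hXv : X v = ev2h u s (Polynomial.derivative Q) := by
    have h1 := congrArg X hv
    rw [map_add, hp, zero_add, der_ev2h X hu, Derivation.leibniz, der_aeval X hu, hc] at h1
    simp only [smul_eq_mul, mul_zero, add_zero] at h1
    apply mul_left_cancel₀ hcu0
    rw [← h1, mul_comm]
  have transc : ∀ q : Polynomial K, Irreducible q → ∀ G : Polynomial (Polynomial K),
      Polynomial.aeval u q ∣ ev2h u s G → Polynomial.C q ∣ G := by
    intro q hq G hG
    by_contra hn
    obtain ⟨a, ha⟩ := alg_closed_q hco hq s G hn hG
    exact min_slice_contra X hco hu hs hq _ (der_aeval X hu a) ha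
  have hQ' : ∀ q : Polynomial K, Irreducible q → q ∣ c →
      ¬ Polynomial.aeval u q ∣ ev2h u s (Polynomial.derivative Q) := by
    intro q hq hqc hd
    have h1 := dvd_of_derivative (K := K) q Q (transc q hq _ hd)
    have h2 := map_dvd (ev2h u s) h1
    rw [map_sub, ev2h_C, ev2h_C] at h2
    have h3 : Polynomial.aeval u q ∣ p + Polynomial.aeval u (Q.coeff 0) := by
      have h4 : Polynomial.aeval u q ∣ p + ev2h u s Q := by
        rw [hv]; exact (map_dvd (Polynomial.aeval u) hqc).mul_right v
      have := dvd_sub h4 h2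
      convert this using 1
      ring
    obtain ⟨t, ht⟩ := h3
    have hXt : X t = 0 := by
      have h5 := congrArg X ht
      rw [map_add, hp, der_aeval X hu, Derivation.leibniz, der_aeval X hu] at h5
      simp only [smul_eq_mul, mul_zero, add_zero] at h5
      exact (mul_eq_zero.1 h5.symm).resolve_left (aeval_prime hco hq).ne_zero
    obtain ⟨F, rfl⟩ := exists_ev2h (hker t hXt)
    have h6 : ev2h u p (Polynomial.X + Polynomial.C (Q.coeff 0) - Polynomial.C q * F) = 0 := by
      rw [map_sub, map_add, map_mul, ev2h_X, ev2h_C, ev2h_C, ht, sub_self]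
    by_cases h7 : Polynomial.X + Polynomial.C (Q.coeff 0) - Polynomial.C q * F = 0
    · have h8 := congrArg (fun r => Polynomial.coeff r 1) h7
      simp only [Polynomial.coeff_sub, Polynomial.coeff_add, Polynomial.coeff_C_mul,
        Polynomial.coeff_X_one, Polynomial.coeff_C_of_ne_zero one_ne_zero,
        Polynomial.coeff_zero] at h8
      exact hq.not_isUnit (IsUnit.of_mul_eq_one (F.coeff 1) (by linear_combination -h8))
    · obtain ⟨a, ha⟩ := alg_closed_u hco p _ h7 h6
      exact p_not_mem X hln hco hu hker hc0 hc a ha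
  have key : ∀ q : Polynomial K, Irreducible q → q ∣ c → ∀ (n : ℕ)
      (G : Polynomial (Polynomial (Polynomial K))), G.natDegree ≤ n →
      Polynomial.aeval u q ∣ ev3 u s v G → Polynomial.C (Polynomial.C q) ∣ G := by
    intro q hq hqc n
    induction n with
    | zero =>
      intro G hG hd
      rw [Polynomial.eq_C_of_natDegree_le_zero hG] at hd ⊢
      rw [ev3_C] at hd
      exact map_dvd Polynomial.C (transc q hq _ hd)
    | succ n ih =>
      intro G hG hd
      have hpr := aeval_prime hco hq
      have h1 : Polynomial.aeval u q ∣ X (ev3 u s v G) := by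
        obtain ⟨t, ht⟩ := hd
        rw [ht, Derivation.leibniz, der_aeval X hu, smul_zero, add_zero, smul_eq_mul]
        exact dvd_mul_right _ _
      obtain ⟨Z, hZ⟩ := der_ev3 X hu s v G
      rw [hZ, hXv, hc, dvd_add_left ((map_dvd (Polynomial.aeval u) hqc).mul_left Z)] at h1
      have h2 := (hpr.dvd_or_dvd h1).resolve_right (hQ' q hq hqc)
      have h3 := ih _ (by have := Polynomial.natDegree_derivative_le G; omega) h2
      have h4 : Polynomial.C (Polynomial.C q) ∣ G - Polynomial.C (G.coeff 0) :=
        dvd_of_derivative (K := K) _ G h3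
      have h5 := map_dvd (ev3 u s v) h4
      rw [← aeval_eq_ev3, ev3_sub, dvd_sub_right hd, ev3_C] at h5
      have h6 := map_dvd Polynomial.C (transc q hq _ h5)
      exact poly_dvd_of_sub h4 h6
  have hcancel : ∀ d : Polynomial K, d ∣ c → ∀ f : PolyR K,
      Polynomial.aeval u d * f ∈ Algebra.adjoin K {u, s, v} → f ∈ Algebra.adjoin K {u, s, v} := by
    intro d
    induction d using WfDvdMonoid.induction_on_irreducible with
    | zero => intro h0; exact absurd (zero_dvd_iff.1 h0) hc0
    | unit d hd =>
      intro _ f hf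
      obtain ⟨d', hd'⟩ := hd.exists_left_inv
      have h1 : f = Polynomial.aeval u d' * (Polynomial.aeval u d * f) := by
        rw [← mul_assoc, ← map_mul, hd', map_one, one_mul]
      rw [h1]
      exact Subalgebra.mul_mem _ (aeval_mem_of_mem _ (Algebra.subset_adjoin (by simp)) _) hf
    | mul a q ha hq ih =>
      intro hqa f hf
      apply ih ((dvd_mul_left a q).trans hqa)
      rw [map_mul, mul_assoc] at hf
      obtain ⟨G, hG⟩ := exists_ev3 hf
      obtain ⟨G', rfl⟩ := key q hq ((dvd_mul_right q a).trans hqa) _ G le_rfl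
        ⟨_, hG⟩
      rw [map_mul, ← aeval_eq_ev3] at hG
      rw [← mul_left_cancel₀ (aeval_prime hco hq).ne_zero hG]
      exact ev3_mem _ (Algebra.subset_adjoin (by simp)) (Algebra.subset_adjoin (by simp))
        (Algebra.subset_adjoin (by simp)) _
  have hpB : p ∈ Algebra.adjoin K {u, s, v} := by
    have h1 : p = Polynomial.aeval u c * v - ev2h u s Q := by rw [← hv]; ring
    rw [h1]
    have hu' : u ∈ Algebra.adjoin K {u, s, v} := Algebra.subset_adjoin (by simp)
    exact Subalgebra.sub_mem _ (Subalgebra.mul_mem _ (aeval_mem_of_mem _ hu' _)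
      (Algebra.subset_adjoin (by simp))) (ev2h_mem _ hu' (Algebra.subset_adjoin (by simp)) _)
  refine ⟨u, s, v, ?_, ?_, ?_, ?_⟩
  · show Algebra.adjoin K {u, s, v} = ⊤
    rw [eq_top_iff]
    intro f _
    obtain ⟨n, hn⟩ := local_slice_gen X hln (Algebra.adjoin K {u, s, v})
      (fun b hb => by
        have h1 : Algebra.adjoin K {u, p} ≤ Algebra.adjoin K {u, s, v} := by
          refine Algebra.adjoin_le ?_
          rintro x (rfl | rfl)
          · exact Algebra.subset_adjoin (by simp)
          · exact hpB
        exact h1 (hker b hb)) s _ hc (der_aeval X hu c) (Algebra.subset_adjoin (by simp)) f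
    clear * - hcancel hn
    induction n with
    | zero => simpa using hn
    | succ n ih =>
      apply ih
      apply hcancel c dvd_rfl
      rwa [← mul_assoc, ← pow_succ']
  · rw [hu]; exact Subalgebra.zero_mem _
  · rw [hc]; exact aeval_mem_of_mem _ (Algebra.subset_adjoin (by simp)) _
  · rw [hXv]
    exact ev2h_mem _ (Algebra.subset_adjoin (by simp)) (Algebra.subset_adjoin (by simp)) _

theorem frac_mem {L M : Type} [Field L] [CommRing M] [IsDomain M] (i : L →+* M)
    (hunit : ∀ m : M, IsUnit m → ∃ l, i l = m) (P S : M) (α F : Polynomial L)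
    (hα : Polynomial.eval₂ i P α ≠ 0)
    (h : Polynomial.eval₂ i P α * S = Polynomial.eval₂ i P F) :
    ∃ G : Polynomial L, S = Polynomial.eval₂ i P G := by
  classical
  have hα0 : α ≠ 0 := by rintro rfl; simp at hα
  obtain ⟨α', hα'⟩ := EuclideanDomain.gcd_dvd_left α F
  obtain ⟨F', hF'⟩ := EuclideanDomain.gcd_dvd_right α F
  have hb := EuclideanDomain.gcd_eq_gcd_ab α F
  set d := EuclideanDomain.gcd α F with hd
  have hd0 : d ≠ 0 := by
    intro h0; rw [h0, zero_mul] at hα'; exact hα0 hα'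
  have hco : α' * EuclideanDomain.gcdA α F + F' * EuclideanDomain.gcdB α F = 1 := by
    apply mul_left_cancel₀ hd0
    calc d * (α' * EuclideanDomain.gcdA α F + F' * EuclideanDomain.gcdB α F)
        = (d * α') * EuclideanDomain.gcdA α F + (d * F') * EuclideanDomain.gcdB α F := by ring
      _ = d * 1 := by rw [← hα', ← hF', mul_one, ← hb]
  generalize EuclideanDomain.gcdA α F = A at hco
  generalize EuclideanDomain.gcdB α F = B at hco
  have h1 : Polynomial.eval₂ i P α' * S = Polynomial.eval₂ i P F' := by
    rw [hα', Polynomial.eval₂_mul] at hα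
    rw [hα', hF', Polynomial.eval₂_mul, Polynomial.eval₂_mul, mul_assoc] at h
    exact mul_left_cancel₀ (left_ne_zero_of_mul hα) h
  have h2 := congrArg (Polynomial.eval₂ i P) hco
  rw [Polynomial.eval₂_add, Polynomial.eval₂_mul, Polynomial.eval₂_mul, Polynomial.eval₂_one,
    ← h1] at h2
  have h3 : Polynomial.eval₂ i P α' *
      (Polynomial.eval₂ i P A + S * Polynomial.eval₂ i P B) = 1 := by
    rw [← h2]; ring
  obtain ⟨l, hl⟩ := hunit (Polynomial.eval₂ i P A + S * Polynomial.eval₂ i P B)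
    (IsUnit.of_mul_eq_one (Polynomial.eval₂ i P α') (by rw [mul_comm]; exact h3))
  refine ⟨Polynomial.C l * F', ?_⟩
  rw [Polynomial.eval₂_mul, Polynomial.eval₂_C, hl, ← h1]
  linear_combination (-S) * h3

theorem unit_CC {L : Type} [Field L] (m : Polynomial (Polynomial L)) (hm : IsUnit m) :
    ∃ l, (Polynomial.C.comp Polynomial.C : L →+* Polynomial (Polynomial L)) l = m := by
  obtain ⟨r, hr, rfl⟩ := Polynomial.isUnit_iff.1 hm
  obtain ⟨l, -, rfl⟩ := Polynomial.isUnit_iff.1 hr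
  exact ⟨l, rfl⟩

theorem redq_eval₂ {K : Type} [Field K] (q : Polynomial K)
    (P : Polynomial (Polynomial (Polynomial K))) (G : Polynomial (Polynomial K)) :
    redq q (Polynomial.eval₂ (Polynomial.C.comp Polynomial.C) P G) =
      Polynomial.eval₂ (Polynomial.C.comp Polynomial.C) (redq q P)
        (G.map (AdjoinRoot.mk q)) := by
  rw [Polynomial.hom_eval₂, Polynomial.eval₂_map]
  congr 1
  exact RingHom.ext fun a => redq_CC q a

/-- If `α(u,p)·s ∈ K[u,p] + q(u)A` with `q ∤ α(u,p)` then `s ∈ K[u,p] + q(u)A`. -/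
theorem frac_q {K : Type} [Field K] {u v w : PolyR K}
    (h : Algebra.adjoin K {u, v, w} = ⊤) {q : Polynomial K} (hq : Irreducible q) (p s : PolyR K)
    (α F : Polynomial (Polynomial K)) (hα : ¬ Polynomial.aeval u q ∣ ev2h u p α)
    (hd : Polynomial.aeval u q ∣ ev2h u p α * s - ev2h u p F) :
    ∃ G, Polynomial.aeval u q ∣ s - ev2h u p G := by
  have : Fact (Irreducible q) := ⟨hq⟩
  obtain ⟨P, rfl⟩ := (ev3_bij h).2 p
  obtain ⟨S, rfl⟩ := (ev3_bij h).2 s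
  rw [ev2h_ev3, aeval_eq_ev3 u v w, ev3_dvd h, ← redq_eq_zero, redq_eval₂] at hα
  rw [ev2h_ev3, ev2h_ev3, aeval_eq_ev3 u v w, ← map_mul, ← map_sub, ev3_dvd h, ← redq_eq_zero,
    redq_sub, map_mul, sub_eq_zero, redq_eval₂, redq_eval₂] at hd
  obtain ⟨G, hG⟩ := frac_mem (Polynomial.C.comp Polynomial.C) unit_CC (redq q P) (redq q S)
    (α.map (AdjoinRoot.mk q)) (F.map (AdjoinRoot.mk q)) hα hd
  obtain ⟨G, rfl⟩ := Polynomial.map_surjective _ AdjoinRoot.mk_surjective G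
  refine ⟨G, ?_⟩
  rw [ev2h_ev3, aeval_eq_ev3 u v w, ← map_sub, ev3_dvd h, ← redq_eq_zero, redq_sub,
    redq_eval₂, hG, sub_self]

theorem coord_mem {K : Type} [Field K] {u v w u1 : PolyR K}
    (h : Algebra.adjoin K {u, v, w} = ⊤) (φ ψ : Polynomial K) (hψ : 0 < ψ.natDegree)
    (he : Polynomial.aeval u φ = Polynomial.aeval u1 ψ) :
    ∃ b : Polynomial K, u1 = Polynomial.aeval u b := by
  refine alg_closed_u h u1 (ψ.map Polynomial.C - Polynomial.C φ) ?_ ?_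
  · intro h0
    have h1 := congrArg Polynomial.natDegree (sub_eq_zero.1 h0)
    rw [Polynomial.natDegree_map_eq_of_injective Polynomial.C_injective,
      Polynomial.natDegree_C] at h1
    omega
  · rw [map_sub, ev2h_C, he, sub_eq_zero]
    show Polynomial.eval₂ _ _ _ = _
    rw [Polynomial.eval₂_map, Polynomial.aeval_def]
    congr 1
    refine RingHom.ext fun a => ?_
    show Polynomial.aeval u (Polynomial.C a) = _
    rw [Polynomial.aeval_C]

theorem exists_irr_factor {K : Type} [Field K] {u1 π : PolyR K}
    (hπ : Prime π) (a : Polynomial K) : a ≠ 0 → π ∣ Polynomial.aeval u1 a →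
    ∃ r : Polynomial K, Irreducible r ∧ π ∣ Polynomial.aeval u1 r := by
  induction a using WfDvdMonoid.induction_on_irreducible with
  | zero => intro h0; exact absurd rfl h0
  | unit d hd =>
    intro _ h2
    exact absurd (isUnit_of_dvd_unit h2 (hd.map (Polynomial.aeval u1))) hπ.not_isUnit
  | mul a r ha hr ih =>
    intro _ h2
    rw [map_mul] at h2
    rcases hπ.dvd_or_dvd h2 with h3 | h3
    · exact ⟨r, hr, h3⟩
    · exact ih ha h3

/-- Structure of elements whose derivative vanishes modulo `d`. -/
theorem tri_mod {K : Type} [Field K] [CharZero K] (X : Derivation K (PolyR K) (PolyR K))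
    (hirr : IrredDer K X) {u v w : PolyR K} (h : Algebra.adjoin K {u, v, w} = ⊤) (hu : X u = 0)
    (d : Polynomial K) (hd : Polynomial.aeval u d ∣ X v) (f : PolyR K)
    (hf : Polynomial.aeval u d ∣ X f) :
    ∃ F, Polynomial.aeval u d ∣ f - ev2h u v F := by
  have hrel : IsRelPrime (Polynomial.aeval u d) (X w) := by
    intro t ht1 ht2
    refine hirr t fun i => ?_
    obtain ⟨F, hF⟩ := (ev3_bij h).2 (MvPolynomial.X i)
    obtain ⟨Z, hZ⟩ := der_ev3 X hu v w F
    rw [← hF, hZ]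
    exact dvd_add (ht2.mul_left _) ((ht1.trans hd).mul_left _)
  obtain ⟨F, rfl⟩ := (ev3_bij h).2 f
  obtain ⟨Z, hZ⟩ := der_ev3 X hu v w F
  rw [hZ, dvd_add_left (hd.mul_left Z)] at hf
  have h1 := hrel.dvd_of_dvd_mul_right hf
  rw [aeval_eq_ev3 u v w, ev3_dvd h] at h1
  have h2 : Polynomial.C (Polynomial.C d) ∣ F - Polynomial.C (F.coeff 0) :=
    dvd_of_derivative (K := K) _ F h1
  refine ⟨F.coeff 0, ?_⟩
  have h3 := map_dvd (ev3 u v w) h2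
  rwa [ev3_sub, ← aeval_eq_ev3, ev3_C] at h3

/-- The forward direction once the triangular system starts with `u`. -/
theorem fwd_same {K : Type} [Field K] [CharZero K] (X : Derivation K (PolyR K) (PolyR K))
    (hirr : IrredDer K X) {u p s v w : PolyR K} (h : Algebra.adjoin K {u, v, w} = ⊤)
    (hu : X u = 0) (hp : X p = 0) (hker : ∀ a, X a = 0 → a ∈ Algebra.adjoin K {u, p})
    (hs : IsMinLocalSlice K X s) {c : Polynomial K} (hc : X s = Polynomial.aeval u c)
    (a : Polynomial K) (ha : X v = Polynomial.aeval u a) :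
    ∃ Q ℓ : Polynomial (Polynomial K),
      Polynomial.aeval u c ∣ p + ev2h u (s + ev2h u p ℓ) Q := by
  classical
  have hc0 : c ≠ 0 := by
    rintro rfl
    exact hs.1.1 (by rw [hc, map_zero])
  have hca : c ∣ a := by
    have hb := EuclideanDomain.gcd_eq_gcd_ab a c
    obtain ⟨k, hk⟩ := EuclideanDomain.gcd_dvd_right a c
    have hda := EuclideanDomain.gcd_dvd_left a c
    set d := EuclideanDomain.gcd a c with hd
    generalize EuclideanDomain.gcdA a c = A at hb
    generalize EuclideanDomain.gcdB a c = B at hb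
    have hX : X (Polynomial.aeval u A * v + Polynomial.aeval u B * s) = Polynomial.aeval u d := by
      rw [map_add, Derivation.leibniz, Derivation.leibniz, der_aeval X hu, der_aeval X hu, ha, hc,
        hb]
      simp only [smul_eq_mul, mul_zero, add_zero, map_add, map_mul]
      ring
    have hd0 : d ≠ 0 := by rintro h0; rw [h0, zero_mul] at hk; exact hc0 hk
    obtain ⟨μ, hμ⟩ := hs.2 _ ⟨by rw [hX]; exact fun h0 => hd0 (aeval_inj h h0), by
      rw [hX]; exact der_aeval X hu d⟩ (by rw [hX, hc]; exact map_dvd _ ⟨k, hk⟩)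
    rw [hX, hc] at hμ
    exact (aeval_dvd h ⟨_, by rw [hμ, mul_comm]⟩ : c ∣ d).trans hda
  obtain ⟨e, rfl⟩ := hca
  have hcv : Polynomial.aeval u c ∣ X v := by rw [ha]; exact map_dvd _ (dvd_mul_right c e)
  have hX0 : X (v - Polynomial.aeval u e * s) = 0 := by
    rw [map_sub, Derivation.leibniz, der_aeval X hu, ha, hc, map_mul]
    simp only [smul_eq_mul, mul_zero, add_zero]
    ring
  obtain ⟨g, hg⟩ := exists_ev2h (hker _ hX0)
  have hcop : IsCoprime c e := by
    refine isCoprime_of_irreducible_dvd (fun h0 => hc0 h0.1) fun q hq hqc hqe => ?_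
    have hqcu := map_dvd (Polynomial.aeval u) hqc
    have hqeu := map_dvd (Polynomial.aeval u) hqe
    obtain ⟨F, hF⟩ := tri_mod X hirr h hu q (hqcu.trans hcv) s (by rw [hc]; exact hqcu)
    refine min_slice_contra X h hu hs hq (ev2h u (ev2h u p g) F) ?_ ?_
    · rw [der_ev2h X hu, der_ev2h X hu, hp, mul_zero, mul_zero]
    · have h1 := ev2h_sub_dvd u v (ev2h u p g) F
      have h2 : Polynomial.aeval u q ∣ v - ev2h u p g := by
        rw [hg]
        have h3 : v - (v - Polynomial.aeval u e * s) = Polynomial.aeval u e * s := by ring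
        rw [h3]
        exact hqeu.mul_right s
      have h4 := dvd_add hF (h2.trans h1)
      rwa [sub_add_sub_cancel] at h4
  obtain ⟨A, B, hAB⟩ := hcop
  obtain ⟨F, hF⟩ := tri_mod X hirr h hu c hcv p (by rw [hp]; exact dvd_zero _)
  refine ⟨-(F.comp (Polynomial.C e * Polynomial.X)), Polynomial.C B * g, ?_⟩
  set s' := s + ev2h u p (Polynomial.C B * g) with hs'
  have h1 : ev2h u s' (-(F.comp (Polynomial.C e * Polynomial.X))) =
      - ev2h u (Polynomial.aeval u e * s') F := by
    rw [map_neg, neg_inj]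
    show Polynomial.eval₂ _ _ _ = Polynomial.eval₂ _ _ _
    rw [Polynomial.eval₂_comp]
    congr 1
    rw [Polynomial.eval₂_mul, Polynomial.eval₂_C, Polynomial.eval₂_X]
    rfl
  have h2 : Polynomial.aeval u c ∣ v - Polynomial.aeval u e * s' := by
    refine ⟨Polynomial.aeval u A * ev2h u p g, ?_⟩
    have h3 := congrArg (Polynomial.aeval u) hAB
    rw [map_add, map_mul, map_mul, map_one] at h3
    rw [hs', map_mul, ev2h_C]
    linear_combination (-1 : PolyR K) * hg - ev2h u p g * h3
  have h4 := dvd_add hF (h2.trans (ev2h_sub_dvd u v (Polynomial.aeval u e * s') F))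
  rw [sub_add_sub_cancel] at h4
  rw [h1, ← sub_eq_add_neg]
  exact h4

theorem fwd_direction {K : Type} [Field K] [CharZero K] (X : Derivation K (PolyR K) (PolyR K))
    (hln : LND K X) (hirr : IrredDer K X) (hrk : rankD K X = 2)
    {u g h p s : PolyR K} (hco : Algebra.adjoin K {u, g, h} = ⊤) (hu : X u = 0)
    (hp : X p = 0) (hker : ∀ a, X a = 0 → a ∈ Algebra.adjoin K {u, p})
    (hs : IsMinLocalSlice K X s) {c : Polynomial K} (hc : X s = Polynomial.aeval u c)
    (htri : Triangulable K X) :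
    ∃ Q ℓ : Polynomial (Polynomial K),
      Polynomial.aeval u c ∣ p + ev2h u (s + ev2h u p ℓ) Q := by
  obtain ⟨u1, v, w, hco1, hXu1, hXv, hXw⟩ := htri
  change Algebra.adjoin K {u1, v, w} = ⊤ at hco1
  have hc0 : c ≠ 0 := by
    rintro rfl
    exact hs.1.1 (by rw [hc, map_zero])
  have hu1 : X u1 = 0 := by
    obtain ⟨k, hk⟩ := Algebra.mem_bot.1 hXu1
    by_contra hne
    have hk0 : k ≠ 0 := by
      rintro rfl
      exact hne (by rw [← hk, map_zero])
    exact slice_contra X hln hrk hu hp hker hk0 hk.symm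
  have hcu : ¬ IsUnit c := by
    intro hun
    obtain ⟨k, hk, rfl⟩ := Polynomial.isUnit_iff.1 hun
    rw [Polynomial.aeval_C] at hc
    exact slice_contra X hln hrk hu hp hker hk.ne_zero hc
  obtain ⟨a, ha⟩ := exists_aeval hXv
  have ha0 : a ≠ 0 := by
    rintro rfl
    rw [map_zero] at ha
    exact rank_contra X hrk hco1 hu1 ha.symm
  obtain ⟨q, hq, hqc⟩ := WfDvdMonoid.exists_irreducible_factor hcu hc0
  have hpr := aeval_prime hco hq
  have hqa : Polynomial.aeval u q ∣ Polynomial.aeval u1 a := by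
    by_contra hn
    obtain ⟨α, hα⟩ := exists_ev2h (hker _ (der_aeval X hu1 a))
    have hX0 : X (Polynomial.aeval u1 a * s - Polynomial.aeval u c * v) = 0 := by
      rw [map_sub, Derivation.leibniz, Derivation.leibniz, der_aeval X hu, der_aeval X hu1, ← ha,
        hc]
      simp only [smul_eq_mul, mul_zero, add_zero]
      ring
    obtain ⟨F, hF⟩ := exists_ev2h (hker _ hX0)
    rw [← hα] at hn
    obtain ⟨G, hG⟩ := frac_q hco hq p s α F hn (by
      rw [hF, hα, sub_sub_cancel]
      exact (map_dvd (Polynomial.aeval u) hqc).mul_right v)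
    exact min_slice_contra X hco hu hs hq _ (by rw [der_ev2h X hu, hp, mul_zero]) hG
  obtain ⟨r, hr, hqr⟩ := exists_irr_factor hpr a ha0 hqa
  obtain ⟨t, ht⟩ := hqr
  have htu : IsUnit t :=
    ((aeval_prime hco1 hr).irreducible.isUnit_or_isUnit ht).resolve_left hpr.not_isUnit
  obtain ⟨k, hk, rfl⟩ := MvPolynomial.isUnit_iff_eq_C_of_isReduced.1 htu
  have he : Polynomial.aeval u (q * Polynomial.C k) = Polynomial.aeval u1 r := by
    rw [ht, map_mul, Polynomial.aeval_C]; rfl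
  obtain ⟨b, hb⟩ := coord_mem hco _ _ hr.natDegree_pos he
  obtain ⟨b', hb'⟩ := coord_mem hco1 _ _ (by
    rw [Polynomial.natDegree_mul_C hk.ne_zero]; exact hq.natDegree_pos) he.symm
  have hco' : Algebra.adjoin K {u, v, w} = ⊤ := by
    rw [eq_top_iff, ← hco1]
    refine Algebra.adjoin_le ?_
    rintro x (rfl | rfl | rfl)
    · rw [hb]; exact aeval_mem_of_mem _ (Algebra.subset_adjoin (by simp)) _
    · exact Algebra.subset_adjoin (by simp)
    · exact Algebra.subset_adjoin (by simp)
  refine fwd_same X hirr hco' hu hp hker hs hc (a.comp b) ?_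
  rw [← ha, hb, Polynomial.aeval_comp]

/-- Triangulability criterion: `X` is triangulable iff the ideal
`I_c^X = c·K[x,y,z] ∩ K[u,p,s]` contains a polynomial `H = p + Q(u, s + ℓ(u,p))`. -/
theorem triangulability_criterion {K : Type} [Field K] [CharZero K]
    (X : Derivation K (PolyR K) (PolyR K))
    (hln : LND K X) (hirr : IrredDer K X) (hrk : rankD K X = 2)
    (u p : PolyR K) (hu : IsCoord K u)
    (hker : {a : PolyR K | X a = 0} = (Algebra.adjoin K {u, p} : Subalgebra K (PolyR K)))
    (s : PolyR K) (hs : IsMinLocalSlice K X s)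
    (c : Polynomial K) (hc : X s = Polynomial.aeval u c) :
    Triangulable K X ↔
      ∃ Q ℓ : Polynomial (Polynomial K),
        Polynomial.aeval u c ∣ (p + ev2 K u (s + ev2 K u p ℓ) Q) ∧
        (p + ev2 K u (s + ev2 K u p ℓ) Q) ∈ Algebra.adjoin K {u, p, s} := by
  obtain ⟨g, h, hco⟩ := hu
  have hker' : ∀ a, X a = 0 ↔ a ∈ Algebra.adjoin K {u, p} := fun a => by
    have := Set.ext_iff.1 hker a
    simpa using this
  have hXu : X u = 0 := (hker' u).2 (Algebra.subset_adjoin (by simp))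
  have hXp : X p = 0 := (hker' p).2 (Algebra.subset_adjoin (by simp))
  simp only [ev2_eq]
  constructor
  · intro htri
    obtain ⟨Q, ℓ, hd⟩ := fwd_direction X hln hirr hrk hco hXu hXp (fun a => (hker' a).1) hs hc htri
    have hu' : u ∈ Algebra.adjoin K {u, p, s} := Algebra.subset_adjoin (by simp)
    have hp' : p ∈ Algebra.adjoin K {u, p, s} := Algebra.subset_adjoin (by simp)
    have hs' : s ∈ Algebra.adjoin K {u, p, s} := Algebra.subset_adjoin (by simp)
    exact ⟨Q, ℓ, hd, add_mem hp' (ev2h_mem _ hu' (add_mem hs' (ev2h_mem _ hu' hp' ℓ)) Q)⟩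
  · rintro ⟨Q, ℓ, ⟨v, hv⟩, -⟩
    have hXs : X (s + ev2h u p ℓ) = X s := by
      rw [map_add, der_ev2h X hXu, hXp, mul_zero, add_zero]
    refine back_direction X hln hco hXu hXp (fun a => (hker' a).1) (s := s + ev2h u p ℓ) ?_
      (hXs.trans hc) Q hv
    obtain ⟨⟨h1, h2⟩, h3⟩ := hs
    refine ⟨⟨?_, ?_⟩, ?_⟩
    · rwa [hXs]
    · rwa [hXs]
    · rwa [hXs]

end
end
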